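/- arXiv:1908.09408 — 2 statements merged into one kernel-verified Lean document; each statement's English description precedes it below -/
import Mathlib

section
/- Let 1 ≤ l ≤ m ≤ M be integers and let s ∈ ℂ^l satisfy Re(s_j − s_{j+1}) ≥ 1 for j = 1,…,l (convention s_{l+1} = −1). For k ∈ U(M) let B(k) denote its top-left l×m block. Then ∫_{U(M)} N_{l,l}(s, L^{(l)}; B(k) B(k)*) dk = ∏_{j=1}^{l} (M−j)! Γ(s_j+m−l+1) / ((m−j)! Γ(s_j+M−l+1)), where Γ is the Gamma function. (Since B(k)B(k)* is positive semidefinite and C_{l,l}(s) = 1, the inner quantity N_{l,l}(s, L^{(l)}; B(k)B(k)*) equals the spherical function Ψ(s; B(k)) for almost every k.) -/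
open MeasureTheory Matrix Finset Filter

noncomputable section

namespace RMT

instance matMS (l m : ℕ) : MeasurableSpace (Matrix (Fin l) (Fin m) ℂ) :=
  inferInstanceAs (MeasurableSpace (Fin l → Fin m → ℂ))

/-- The real part of the determinant of the leading principal `j × j` submatrix. -/
def pminor {l : ℕ} (y : Matrix (Fin l) (Fin l) ℂ) (j : ℕ) : ℝ :=
  (Matrix.det (Matrix.of fun p q : Fin (min j l) =>
    y (Fin.castLE (min_le_right j l) p) (Fin.castLE (min_le_right j l) q))).re

/-- `s_{j+1}` with the convention `s_{n+1} = -1` (0-based index `j`). -/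
def sNext (n : ℕ) (s : ℕ → ℂ) (j : ℕ) : ℂ := if j + 1 < n then s (j + 1) else -1

/-- `L_{j+1}` with the convention `L_{n+1} = -1` (0-based index `j`). -/
def LNext (n : ℕ) (L : ℕ → ℤ) (j : ℕ) : ℤ := if j + 1 < n then L (j + 1) else -1

/-- The integrand of the spherical function `N_{l,n}(s,L;·)`. -/
def sphProd (n : ℕ) (s : ℕ → ℂ) (L : ℕ → ℤ) {l : ℕ} (y : Matrix (Fin l) (Fin l) ℂ) : ℂ :=
  ∏ j ∈ Finset.range n,
    if pminor y (j + 1) = 0 then 0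
    else ((Real.sign (pminor y (j + 1)) : ℂ) ^ (L j - LNext n L j - 1)) *
      (((|pminor y (j + 1)| : ℝ) : ℂ) ^ (s j - sNext n s j - 1))

/-- The integrand of the normalization constant `C_{l,n}(s)`. -/
def absProd (n : ℕ) (s : ℕ → ℂ) {l : ℕ} (y : Matrix (Fin l) (Fin l) ℂ) : ℂ :=
  ∏ j ∈ Finset.range n,
    if pminor y (j + 1) = 0 then 0
    else (((|pminor y (j + 1)| : ℝ) : ℂ) ^ (s j - sNext n s j - 1))

/-- `μ` is the normalized Haar probability measure of `U(l)`, viewed as a measure on the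
space of `l × l` complex matrices: it is a probability measure, it is carried by the
unitary group, and it is invariant under left translation by every unitary matrix.
(These properties determine `μ` uniquely.) -/
def IsHaarUnitary (l : ℕ) (μ : Measure (Matrix (Fin l) (Fin l) ℂ)) : Prop :=
  IsProbabilityMeasure μ ∧ μ {A | A ∈ Matrix.unitaryGroup (Fin l) ℂ}ᶜ = 0 ∧
    ∀ U ∈ Matrix.unitaryGroup (Fin l) ℂ, μ.map (fun A => U * A) = μ

/-- `N_{l,n}(s, L; x)`. -/
def Nsph (l n : ℕ) (μ : Measure (Matrix (Fin l) (Fin l) ℂ)) (s : ℕ → ℂ) (L : ℕ → ℤ)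
    (x : Matrix (Fin l) (Fin l) ℂ) : ℂ :=
  ∫ k, sphProd n s L (k * x * kᴴ) ∂μ

/-- The l×l diagonal matrix with `n` ones followed by zeros. -/
def projMat (l n : ℕ) : Matrix (Fin l) (Fin l) ℂ :=
  Matrix.diagonal fun i => if (i : ℕ) < n then 1 else 0

/-- The normalization `C_{l,n}(s)`. -/
def Csph (l n : ℕ) (μ : Measure (Matrix (Fin l) (Fin l) ℂ)) (s : ℕ → ℂ) : ℂ :=
  ∫ k, absProd n s (k * projMat l n * kᴴ) ∂μ

/-- The spherical function `Φ_{l,n}(s,L;x) = N_{l,n}(s,L;x)/C_{l,n}(s)`. -/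
def Phi (l n : ℕ) (μ : Measure (Matrix (Fin l) (Fin l) ℂ)) (s : ℕ → ℂ) (L : ℕ → ℤ)
    (x : Matrix (Fin l) (Fin l) ℂ) : ℂ :=
  Nsph l n μ s L x / Csph l n μ s

/-- `L^{(n)} = ((n-1) mod 2, (n-2) mod 2, …, 1, 0)`. -/
def Lstd (n : ℕ) : ℕ → ℤ := fun j => ((n - 1 - j : ℕ) : ℤ) % 2

/-- The spherical function `Ψ(s; g) = Φ_{l,n}(s, L^{(n)}; g g*)` for `g` of rank `n`. -/
def Psi (l m n : ℕ) (μ : Measure (Matrix (Fin l) (Fin l) ℂ)) (s : ℕ → ℂ)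
    (g : Matrix (Fin l) (Fin m) ℂ) : ℂ :=
  Phi l n μ s (Lstd n) (g * gᴴ)

/-- The Vandermonde determinant `Δ_n(a) = ∏_{c>d} (a_c - a_d)` (complex version). -/
def VdmC (n : ℕ) (a : ℕ → ℂ) : ℂ := ∏ c ∈ Finset.range n, ∏ d ∈ Finset.range c, (a c - a d)

/-- The Vandermonde determinant `Δ_n(a) = ∏_{c>d} (a_c - a_d)` (real version). -/
def VdmR (n : ℕ) (a : ℕ → ℝ) : ℝ := ∏ c ∈ Finset.range n, ∏ d ∈ Finset.range c, (a c - a d)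

end RMT

namespace RMT

/-- The top-left `l × m` block of an `M × M` matrix. -/
def topLeftBlock (l m M : ℕ) (hl : l ≤ M) (hm : m ≤ M)
    (k : Matrix (Fin M) (Fin M) ℂ) : Matrix (Fin l) (Fin m) ℂ :=
  Matrix.of fun i j => k (Fin.castLE hl i) (Fin.castLE hm j)

/-- power with the convention `0 ↦ 0`. -/
def gp (a : ℂ) (x : ℝ) : ℂ := if x = 0 then 0 else ((|x| : ℝ) : ℂ) ^ a

lemma gp_zero (a : ℂ) : gp a 0 = 0 := by simp [gp]

lemma gp_one (a : ℂ) : gp a 1 = 1 := by simp [gp]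

lemma gp_mul (a : ℂ) (x y : ℝ) : gp a (x * y) = gp a x * gp a y := by
  unfold gp
  by_cases hx : x = 0
  · simp [hx]
  by_cases hy : y = 0
  · simp [hy]
  simp only [mul_eq_zero, hx, hy, or_self, if_false, abs_mul]
  rw [Complex.ofReal_mul, Complex.mul_cpow_ofReal_nonneg (abs_nonneg _) (abs_nonneg _)]

lemma gp_inv (a : ℂ) (x : ℝ) : gp a x⁻¹ = gp (-a) x := by
  unfold gp
  by_cases hx : x = 0
  · simp [hx]
  simp only [inv_eq_zero, hx, if_false, abs_inv]
  rw [Complex.ofReal_inv, Complex.inv_cpow, Complex.cpow_neg]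
  rw [Complex.arg_ofReal_of_nonneg (abs_nonneg _)]
  exact Real.pi_ne_zero.symm

lemma gp_add (a b : ℂ) (x : ℝ) : gp (a + b) x = gp a x * gp b x := by
  unfold gp
  by_cases hx : x = 0
  · simp [hx]
  simp only [hx, if_false]
  rw [Complex.cpow_add]
  simpa using hx

lemma measurable_gp (a : ℂ) : Measurable (gp a) := by
  unfold gp
  refine Measurable.ite (measurableSet_singleton 0) measurable_const ?_
  fun_prop

lemma norm_gp (a : ℂ) (x : ℝ) : ((‖gp a x‖ : ℝ) : ℂ) = gp (a.re) x := by
  unfold gp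
  by_cases hx : x = 0
  · simp [hx]
  simp only [hx, if_false]
  rw [Complex.norm_cpow_eq_rpow_re_of_pos (abs_pos.2 hx), Complex.ofReal_cpow (abs_nonneg _)]

lemma norm_gp_le (a : ℂ) (ha : 0 ≤ a.re) (x C : ℝ) (hC : |x| ≤ C) : ‖gp a x‖ ≤ C ^ a.re := by
  unfold gp
  have : 0 ≤ C := (abs_nonneg _).trans hC
  by_cases hx : x = 0
  · simp [hx]; positivity
  simp only [hx, if_false]
  rw [Complex.norm_cpow_eq_rpow_re_of_pos (abs_pos.2 hx)]
  gcongr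

/-- Gaussian density on `ℂ`. -/
def w1 (z : ℂ) : ℝ := Real.pi⁻¹ * Real.exp (-‖z‖ ^ 2)

lemma w1_nonneg (z : ℂ) : 0 ≤ w1 z := by unfold w1; have := Real.pi_pos; positivity

lemma measurable_w1 : Measurable w1 := by unfold w1; fun_prop

lemma integral_w1 : ∫ z, w1 z = 1 := by
  unfold w1
  rw [integral_const_mul]
  have := Complex.integral_exp_neg_rpow (p := 2) (by norm_num)
  simp only [Real.rpow_two] at this
  rw [this]
  have h2 : (2 / 2 + 1 : ℝ) = 2 := by norm_num
  rw [h2, Real.Gamma_two]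
  field_simp

lemma integrable_w1 : Integrable w1 := .of_integral_ne_zero (by rw [integral_w1]; exact one_ne_zero)

/-- standard complex Gaussian -/
def γ1 : Measure ℂ := volume.withDensity fun z => ENNReal.ofReal (w1 z)

instance : IsProbabilityMeasure γ1 := by
  constructor
  rw [γ1, withDensity_apply _ MeasurableSet.univ, Measure.restrict_univ,
    ← ofReal_integral_eq_lintegral_ofReal integrable_w1 (ae_of_all _ w1_nonneg), integral_w1]
  simp

/-- standard complex Gaussian vector -/
def γ (ι : Type) [Fintype ι] : Measure (ι → ℂ) := Measure.pi fun _ => γ1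

instance (ι : Type) [Fintype ι] : IsProbabilityMeasure (γ ι) := by unfold γ; infer_instance

lemma γ_eq (ι : Type) [Fintype ι] :
    γ ι = volume.withDensity fun v => ENNReal.ofReal (∏ i, w1 (v i)) := by
  unfold γ
  refine Measure.pi_eq fun s hs => ?_
  rw [withDensity_apply _ (MeasurableSet.univ_pi hs), ← ofReal_integral_eq_lintegral_ofReal,
    volume_pi, Measure.restrict_pi_pi, integral_fintype_prod_eq_prod (fun i => w1),
    ENNReal.ofReal_prod_of_nonneg]
  · refine Finset.prod_congr rfl fun i _ => ?_
    rw [γ1, withDensity_apply _ (hs i), ofReal_integral_eq_lintegral_ofReal]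
    · exact integrable_w1.restrict
    · exact ae_of_all _ w1_nonneg
  · intro i _
    exact integral_nonneg w1_nonneg
  · refine Integrable.restrict ?_
    exact Integrable.fintype_prod (fun _ => integrable_w1)
  · exact ae_of_all _ fun v => Finset.prod_nonneg fun i _ => w1_nonneg _

lemma prod_w1 (ι : Type) [Fintype ι] (v : ι → ℂ) :
    ∏ i, w1 (v i) = (Real.pi⁻¹) ^ (Fintype.card ι) * Real.exp (-∑ i, ‖v i‖ ^ 2) := by
  simp only [w1, Finset.prod_mul_distrib, Finset.prod_const, ← Real.exp_sum, Finset.sum_neg_distrib,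
    Finset.card_univ]

/-- restriction to a sub-family of coordinates -/
lemma γ_restrict {ι κ : Type} [Fintype ι] [Fintype κ] (e : κ → ι) (he : Function.Injective e) :
    MeasurePreserving (fun (v : ι → ℂ) (k : κ) => v (e k)) (γ ι) (γ κ) := by
  classical
  refine ⟨by fun_prop, ?_⟩
  symm
  unfold γ
  refine Measure.pi_eq fun s hs => ?_
  rw [Measure.map_apply (by fun_prop) (MeasurableSet.univ_pi hs)]
  have : (fun (v : ι → ℂ) (k : κ) => v (e k)) ⁻¹' (Set.univ.pi s) =
      Set.univ.pi (fun i => if h : ∃ k, e k = i then s h.choose else Set.univ) := by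
    ext v
    simp only [Set.mem_preimage, Set.mem_pi, Set.mem_univ, true_imp_iff]
    constructor
    · intro h i
      split_ifs with hi
      · have := h hi.choose
        rwa [hi.choose_spec] at this
      · trivial
    · intro h k
      have h1 := h (e k)
      have hk : ∃ k', e k' = e k := ⟨k, rfl⟩
      rw [dif_pos hk, he hk.choose_spec] at h1
      exact h1
  rw [this, Measure.pi_pi]
  rw [← Finset.prod_subset (Finset.subset_univ (Finset.univ.image e)),
    Finset.prod_image (fun a _ b _ h => he h)]
  · refine Finset.prod_congr rfl fun k _ => ?_
    have hk : ∃ k', e k' = e k := ⟨k, rfl⟩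
    rw [dif_pos hk, he hk.choose_spec]
  · intro i _ hi
    have : ¬ ∃ k, e k = i := by simpa using hi
    rw [dif_neg this]; simp

/-- unitary invariance -/
lemma γ_unitary {ι : Type} [Fintype ι] [DecidableEq ι] (U : Matrix ι ι ℂ)
    (hU : U ∈ Matrix.unitaryGroup ι ℂ) :
    MeasurePreserving (fun v : ι → ℂ => v ᵥ* U) (γ ι) (γ ι) := by
  have hdet : ‖U.det‖ = 1 := by
    have := Matrix.det_of_mem_unitary hU
    exact CStarRing.norm_of_mem_unitary this
  have hcont : Continuous (fun v : ι → ℂ => v ᵥ* U) := by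
    unfold Matrix.vecMul dotProduct; fun_prop
  have hmeas : Measurable (fun v : ι → ℂ => v ᵥ* U) := hcont.measurable
  let f : (ι → ℂ) →ₗ[ℝ] (ι → ℂ) := (Matrix.vecMulLinear U).restrictScalars ℝ
  have hf : LinearMap.det f = 1 := by
    simp only [f]
    rw [LinearMap.det_restrictScalars]
    have : LinearMap.det (Matrix.vecMulLinear U) = U.det := by
      have : Matrix.vecMulLinear U = Matrix.toLin' Uᵀ := by
        ext v; simp
      rw [this, LinearMap.det_toLin', Matrix.det_transpose]
    rw [this, Algebra.norm_complex_apply, Complex.normSq_eq_norm_sq, hdet]; norm_num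
  have hvol : MeasurePreserving (fun v : ι → ℂ => v ᵥ* U) volume volume := by
    refine ⟨hmeas, ?_⟩
    have := Measure.map_linearMap_addHaar_eq_smul_addHaar (volume : Measure (ι → ℂ)) (f := f)
      (by rw [hf]; exact one_ne_zero)
    rw [hf] at this
    simp only [inv_one, abs_one, ENNReal.ofReal_one, one_smul] at this
    exact this
  have hsum : ∀ v : ι → ℂ, ∑ i, ‖(v ᵥ* U) i‖ ^ 2 = ∑ i, ‖v i‖ ^ 2 := by
    intro v
    have key : (v ᵥ* U) ⬝ᵥ star (v ᵥ* U) = v ⬝ᵥ star v := by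
      rw [Matrix.star_vecMul, Matrix.dotProduct_mulVec, Matrix.vecMul_vecMul]
      have : U * Uᴴ = 1 := (Matrix.mem_unitaryGroup_iff).1 hU
      rw [this, Matrix.vecMul_one]
    have h2 : ∀ u : ι → ℂ, u ⬝ᵥ star u = ((∑ i, ‖u i‖ ^ 2 : ℝ) : ℂ) := by
      intro u
      simp [dotProduct, Complex.mul_conj, Complex.normSq_eq_norm_sq]
    rw [h2, h2] at key
    exact_mod_cast key
  refine ⟨hmeas, ?_⟩
  ext s hs
  rw [Measure.map_apply hmeas hs, γ_eq, withDensity_apply _ hs, withDensity_apply _ (hmeas hs)]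
  rw [← hvol.setLIntegral_comp_preimage hs]
  · simp only [prod_w1, hsum]
  · have := measurable_w1
    fun_prop

lemma radial_aux (ι : Type) [Fintype ι] [Nonempty ι] : ∃ K : ℂ, ∀ a : ℂ, 0 ≤ a.re →
    ∫ v : ι → ℂ, gp a (∑ i, ‖v i‖ ^ 2) ∂(γ ι) = K * Complex.Gamma (Fintype.card ι + a) := by
  let e : (ι → ℂ) ≃L[ℝ] EuclideanSpace ℂ ι :=
    (PiLp.continuousLinearEquiv 2 ℝ (fun _ : ι => ℂ)).symm
  let ν : Measure (EuclideanSpace ℂ ι) := Measure.map e volume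
  have : ν.IsAddHaarMeasure := e.isAddHaarMeasure_map _
  set n := Fintype.card ι with hn
  have hnpos : 0 < n := Fintype.card_pos
  have hdim : Module.finrank ℝ (EuclideanSpace ℂ ι) = 2 * n := by
    rw [← Module.finrank_mul_finrank ℝ ℂ (EuclideanSpace ℂ ι)]
    simp [hn]
  refine ⟨(2 * n : ℕ) * (ν.real (Metric.ball 0 1) : ℂ) * ((Real.pi⁻¹ ^ n : ℝ) : ℂ) * (1 / 2), fun a ha => ?_⟩
  have hnorm : ∀ v : ι → ℂ, ∑ i, ‖v i‖ ^ 2 = ‖e v‖ ^ 2 := by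
    intro v
    rw [EuclideanSpace.norm_sq_eq]
    rfl
  let F : ℝ → ℂ := fun r => ((Real.pi⁻¹ ^ n * Real.exp (- r ^ 2) : ℝ) : ℂ) * gp a (r ^ 2)
  have h1 : ∫ v : ι → ℂ, gp a (∑ i, ‖v i‖ ^ 2) ∂(γ ι) = ∫ v : ι → ℂ, F ‖e v‖ := by
    rw [γ_eq, integral_withDensity_eq_integral_toReal_smul]
    · refine integral_congr_ae (ae_of_all _ fun v => ?_)
      simp only [F]
      rw [ENNReal.toReal_ofReal (Finset.prod_nonneg fun i _ => w1_nonneg _), prod_w1, hnorm,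
        Complex.real_smul]
    · have := measurable_w1
      fun_prop
    · exact ae_of_all _ fun v => ENNReal.ofReal_lt_top
  have h2 : ∫ v : ι → ℂ, F ‖e v‖ = ∫ x, F ‖x‖ ∂ν := by
    exact (e.toHomeomorph.measurableEmbedding.integral_map (fun x => F ‖x‖)).symm
  have h3 : ∫ y in Set.Ioi (0 : ℝ), y ^ (2 * n - 1) • F y =
      ((Real.pi⁻¹ ^ n : ℝ) : ℂ) * (1 / 2) * Complex.Gamma (n + a) := by
    have hre : 0 < ((n : ℂ) + a).re := by
      have : (0 : ℝ) < n := by exact_mod_cast hnpos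
      simp; linarith
    rw [Complex.Gamma_eq_integral hre, Complex.GammaIntegral,
      ← integral_comp_rpow_Ioi_of_pos (g := fun x : ℝ => ((Real.exp (-x) : ℝ) : ℂ) *
        (x : ℂ) ^ ((n : ℂ) + a - 1)) (p := 2) (by norm_num), ← integral_const_mul]
    refine setIntegral_congr_fun measurableSet_Ioi fun x hx => ?_
    have hx : 0 < x := hx
    simp only [F, gp]
    have hx2 : x ^ 2 ≠ 0 := by positivity
    have hxc : (x : ℂ) ≠ 0 := by exact_mod_cast hx.ne'
    rw [if_neg hx2, abs_of_pos (by positivity), Real.rpow_two]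
    simp only [Complex.real_smul]
    have e1 : (((x ^ 2 : ℝ)) : ℂ) ^ ((n : ℂ) + a - 1) =
        ((x ^ 2 : ℝ) : ℂ) ^ a * (x : ℂ) ^ (2 * n - 2) := by
      have : ((n : ℂ) + a - 1) = a + ((n - 1 : ℕ) : ℂ) := by
        rw [Nat.cast_sub hnpos]; push_cast; ring
      rw [this, Complex.cpow_add _ _ (by exact_mod_cast hx2), Complex.cpow_natCast]
      congr 1
      push_cast
      rw [← pow_mul]; congr 1; omega
    rw [e1]
    have e2 : (2 : ℝ) - 1 = 1 := by norm_num
    rw [e2, Real.rpow_one]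
    have e3 : x ^ (2 * n - 1) = x * x ^ (2 * n - 2) := by
      rw [← pow_succ']; congr 1; omega
    rw [e3]
    push_cast
    ring
  rw [h1, h2, integral_fun_norm_addHaar ν F, hdim, h3]
  simp only [nsmul_eq_mul, Complex.real_smul]
  ring

lemma radial (ι : Type) [Fintype ι] [Nonempty ι] (a : ℂ) (ha : 0 ≤ a.re) :
    ∫ v : ι → ℂ, gp a (∑ i, ‖v i‖ ^ 2) ∂(γ ι) =
      Complex.Gamma (Fintype.card ι + a) / Complex.Gamma (Fintype.card ι) := by
  obtain ⟨K, hK⟩ := radial_aux ι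
  have h0 := hK 0 (by simp)
  have hz : ∫ v : ι → ℂ, gp 0 (∑ i, ‖v i‖ ^ 2) ∂(γ ι) = 1 := by
    have : ∀ᵐ v ∂(γ ι), gp 0 (∑ i, ‖v i‖ ^ 2) = 1 := by
      have hne : ∀ᵐ v ∂(γ ι), v ≠ 0 := by
        rw [γ_eq]
        refine (withDensity_absolutelyContinuous _ _).ae_le ?_
        exact compl_mem_ae_iff.2 (measure_singleton (μ := (volume : Measure (ι → ℂ))) 0)
      filter_upwards [hne] with v hv
      have : ∑ i, ‖v i‖ ^ 2 ≠ 0 := by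
        intro h
        rw [Finset.sum_eq_zero_iff_of_nonneg (fun i _ => by positivity)] at h
        apply hv
        ext i
        have := h i (Finset.mem_univ _)
        simpa using this
      simp [gp, this]
    rw [integral_congr_ae this]
    simp
  rw [hz, add_zero] at h0
  rw [hK a ha]
  have hG : Complex.Gamma (Fintype.card ι) ≠ 0 := by
    intro h; rw [h] at h0; simp at h0
  field_simp
  linear_combination (-Complex.Gamma (Fintype.card ι + a)) * h0

/-- append a row -/
def snocM {l m : ℕ} (A : Matrix (Fin l) (Fin m) ℂ) (u : Fin m → ℂ) :
    Matrix (Fin (l + 1)) (Fin m) ℂ :=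
  Matrix.of (Fin.snoc (α := fun _ => Fin m → ℂ) (fun i => A i) u)

lemma snocM_castSucc {l m : ℕ} (A : Matrix (Fin l) (Fin m) ℂ) (u : Fin m → ℂ) (i : Fin l)
    (c : Fin m) : snocM A u i.castSucc c = A i c := by
  simp [snocM]

lemma snocM_last {l m : ℕ} (A : Matrix (Fin l) (Fin m) ℂ) (u : Fin m → ℂ)
    (c : Fin m) : snocM A u (Fin.last l) c = u c := by
  simp [snocM]

/-- Gram minors -/
def D {l m : ℕ} (A : Matrix (Fin l) (Fin m) ℂ) (j : ℕ) : ℝ := pminor (A * Aᴴ) j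

lemma pminor_eq {l : ℕ} (y : Matrix (Fin l) (Fin l) ℂ) {j : ℕ} (h : j ≤ l) :
    pminor y j = (Matrix.det (y.submatrix (Fin.castLE h) (Fin.castLE h))).re := by
  unfold pminor
  have hj : min j l = j := min_eq_left h
  congr 1
  rw [← Matrix.det_submatrix_equiv_self (finCongr hj)]
  rfl

/-- the first `j` rows -/
def rows {l m : ℕ} (A : Matrix (Fin l) (Fin m) ℂ) {j : ℕ} (h : j ≤ l) : Matrix (Fin j) (Fin m) ℂ :=
  A.submatrix (Fin.castLE h) id

lemma D_eq {l m : ℕ} (A : Matrix (Fin l) (Fin m) ℂ) {j : ℕ} (h : j ≤ l) :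
    D A j = (Matrix.det (rows A h * (rows A h)ᴴ)).re := by
  rw [D, pminor_eq _ h]
  rfl

open ComplexOrder in
lemma gram_real {l m : ℕ} (A : Matrix (Fin l) (Fin m) ℂ) : 0 ≤ Matrix.det (A * Aᴴ) :=
  (Matrix.posSemidef_self_mul_conjTranspose A).det_nonneg

open ComplexOrder in
lemma D_nonneg {l m : ℕ} (A : Matrix (Fin l) (Fin m) ℂ) {j : ℕ} (h : j ≤ l) : 0 ≤ D A j := by
  rw [D_eq A h]
  exact (Complex.le_def.1 (gram_real _)).1

lemma D_zero {l m : ℕ} (A : Matrix (Fin l) (Fin m) ℂ) : D A 0 = 1 := by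
  rw [D_eq A (Nat.zero_le _)]; simp

lemma D_mul_unitary {l m : ℕ} (A : Matrix (Fin l) (Fin m) ℂ) (U : Matrix (Fin m) (Fin m) ℂ)
    (hU : U ∈ Matrix.unitaryGroup (Fin m) ℂ) (j : ℕ) : D (A * U) j = D A j := by
  unfold D
  congr 1
  have : U * Uᴴ = 1 := (Matrix.mem_unitaryGroup_iff).1 hU
  rw [Matrix.conjTranspose_mul, Matrix.mul_assoc, ← Matrix.mul_assoc U, this, Matrix.one_mul]

lemma rows_tri {l m : ℕ} (T : Matrix (Fin l) (Fin l) ℂ) (hT : ∀ i j, i < j → T i j = 0)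
    (B : Matrix (Fin l) (Fin m) ℂ) {j : ℕ} (h : j ≤ l) :
    rows (T * B) h = T.submatrix (Fin.castLE h) (Fin.castLE h) * rows B h := by
  ext i c
  simp only [rows, Matrix.submatrix_apply, Matrix.mul_apply, id]
  symm
  refine Finset.sum_of_injOn (Fin.castLE h) ?_ ?_ ?_ ?_
  · exact (Fin.castLE_injective h).injOn
  · intro _ _; simp
  · intro k _ hk
    have : T (Fin.castLE h i) k = 0 := by
      apply hT
      by_contra hlt
      apply hk
      have hkj : (k : ℕ) < j := lt_of_le_of_lt (by simpa [Fin.le_def] using hlt) i.2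
      exact ⟨⟨k, hkj⟩, by simp, by ext; simp⟩
    rw [this, zero_mul]
  · intro k _; rfl

lemma D_tri' {l m : ℕ} (T : Matrix (Fin l) (Fin l) ℂ) (hT : ∀ i j, i < j → T i j = 0)
    (B : Matrix (Fin l) (Fin m) ℂ) {j : ℕ} (h : j ≤ l) :
    D (T * B) j = Complex.normSq (T.submatrix (Fin.castLE h) (Fin.castLE h)).det * D B j := by
  rw [D_eq _ h, rows_tri T hT B h, D_eq _ h, Matrix.conjTranspose_mul]
  set S := T.submatrix (Fin.castLE h) (Fin.castLE h)
  rw [Matrix.mul_assoc, Matrix.det_mul, ← Matrix.mul_assoc, Matrix.det_mul,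
    Matrix.det_conjTranspose]
  have : S.det * ((rows B h * (rows B h)ᴴ).det * star S.det) =
      ((Complex.normSq S.det : ℝ) : ℂ) * (rows B h * (rows B h)ᴴ).det := by
    rw [Complex.normSq_eq_conj_mul_self]
    simp only [starRingEnd_apply]
    ring
  rw [this, Complex.re_ofReal_mul]

lemma D_of_one {l m : ℕ} (E : Matrix (Fin l) (Fin m) ℂ) (hE : E * Eᴴ = 1) {j : ℕ} (h : j ≤ l) :
    D E j = 1 := by
  rw [D, hE, pminor_eq _ h, Matrix.submatrix_one _ (Fin.castLE_injective h)]
  simp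

lemma D_tri {l m : ℕ} (T : Matrix (Fin l) (Fin l) ℂ) (hT : ∀ i j, i < j → T i j = 0)
    (B : Matrix (Fin l) (Fin m) ℂ) {j : ℕ} (h : j ≤ l) :
    D (T * B) j = D T j * D B j := by
  have h1 := D_tri' T hT (1 : Matrix (Fin l) (Fin l) ℂ) h
  rw [Matrix.mul_one, D_of_one (1 : Matrix (Fin l) (Fin l) ℂ) (by simp) h, mul_one] at h1
  rw [D_tri' T hT B h, h1]

lemma exists_unitary {l m : ℕ} (hlm : l ≤ m) (A : Matrix (Fin l) (Fin m) ℂ) :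
    ∃ U ∈ Matrix.unitaryGroup (Fin m) ℂ, ∀ (i : Fin l) (j : Fin m), (i : ℕ) < j → (A * U) i j = 0 := by
  let f : Fin m → EuclideanSpace ℂ (Fin m) := fun k =>
    if h : (k : ℕ) < l then WithLp.toLp 2 (A ⟨k, h⟩) else 0
  have hc : Module.finrank ℂ (EuclideanSpace ℂ (Fin m)) = Fintype.card (Fin m) := by simp
  let b := InnerProductSpace.gramSchmidtOrthonormalBasis hc f
  refine ⟨Matrix.of fun c j => star (b j c), ?_, ?_⟩
  · rw [Matrix.mem_unitaryGroup_iff']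
    ext i j
    have := (orthonormal_iff_ite.1 b.orthonormal) j i
    rw [EuclideanSpace.inner_eq_star_dotProduct] at this
    simp only [dotProduct, Pi.star_apply] at this
    rw [Matrix.mul_apply, Matrix.one_apply]
    simp only [Matrix.star_apply, Matrix.of_apply, star_star]
    rw [this]
    simp [eq_comm]
  · intro i j hij
    have := InnerProductSpace.gramSchmidtOrthonormalBasis_inv_triangular hc f
      (i := Fin.castLE hlm i) (j := j) (by simpa [Fin.lt_def] using hij)
    rw [EuclideanSpace.inner_eq_star_dotProduct] at this
    simp only [dotProduct, Pi.star_apply] at this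
    rw [Matrix.mul_apply]
    rw [← this]
    refine Finset.sum_congr rfl fun c _ => ?_
    simp [f, b]

/-- `[I 0]` -/
def Emat (l m : ℕ) (h : l ≤ m) : Matrix (Fin l) (Fin m) ℂ :=
  (1 : Matrix (Fin m) (Fin m) ℂ).submatrix (Fin.castLE h) id

lemma Emat_mul {l m n : ℕ} (h : l ≤ m) (X : Matrix (Fin m) (Fin n) ℂ) :
    Emat l m h * X = X.submatrix (Fin.castLE h) id := by
  ext i j
  simp [Emat, Matrix.mul_apply, Matrix.one_apply]

lemma Emat_self (l m : ℕ) (h : l ≤ m) : Emat l m h * (Emat l m h)ᴴ = 1 := by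
  rw [Emat_mul]
  ext i j
  simp [Emat, Matrix.one_apply, eq_comm]

lemma tri_decomp {l m : ℕ} (h : l ≤ m) (A : Matrix (Fin l) (Fin m) ℂ)
    (hA : ∀ (i : Fin l) (j : Fin m), (i : ℕ) < j → A i j = 0) :
    A = A.submatrix id (Fin.castLE h) * Emat l m h := by
  ext i j
  simp only [Matrix.mul_apply, Emat, Matrix.submatrix_apply, Matrix.one_apply, id]
  by_cases hj : (j : ℕ) < l
  · rw [Finset.sum_eq_single ⟨j, hj⟩]
    · have : Fin.castLE h ⟨j, hj⟩ = j := by ext; simp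
      simp [this]
    · intro b _ hb
      have : Fin.castLE h b ≠ j := by
        intro hh; apply hb; ext; simp [← hh]
      simp [this]
    · simp
  · rw [hA i j (by omega), Finset.sum_eq_zero]
    intro b _
    have : Fin.castLE h b ≠ j := by
      intro hh; apply hj; simp [← hh]
    simp [this]

lemma D_snoc_lower {l m : ℕ} (A : Matrix (Fin l) (Fin m) ℂ) (v : Fin m → ℂ) {j : ℕ} (h : j ≤ l) :
    D (snocM A v) j = D A j := by
  rw [D_eq _ h, D_eq _ (h.trans (Nat.le_succ l))]
  have : rows (snocM A v) (h.trans (Nat.le_succ l)) =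
      rows A h := by
    ext i c
    have : Fin.castLE (h.trans (Nat.le_succ l)) i = Fin.castSucc (Fin.castLE h i) := by ext; simp
    simp only [rows, Matrix.submatrix_apply, Matrix.of_apply, this, snocM_castSucc, Fin.snoc_castSucc]
  rw [this]

lemma snoc_core {l m : ℕ} (hlm : l < m) (A : Matrix (Fin l) (Fin m) ℂ)
    (hA : ∀ (i : Fin l) (j : Fin m), (i : ℕ) < j → A i j = 0) (u : Fin m → ℂ) :
    D (snocM A u) (l + 1) =
      D A l * ∑ k : Fin (m - l), ‖u ⟨l + k, by omega⟩‖ ^ 2 := by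
  let S : Matrix (Fin (l + 1)) (Fin (l + 1)) ℂ := 
    snocM (Matrix.of fun i => Fin.snoc (α := fun _ => ℂ) (fun k => A i (Fin.castLE hlm.le k)) 0)
      (Fin.snoc (α := fun _ => ℂ) (fun k => u (Fin.castLE hlm.le k)) 1)
  let R : Matrix (Fin (l + 1)) (Fin m) ℂ := 
    snocM (Emat l m hlm.le) (fun c => if (c : ℕ) < l then 0 else u c)
  have hS : ∀ i j, i < j → S i j = 0 := by
    intro i j hij
    induction i using Fin.lastCases with
    | last => exact absurd hij (not_lt.2 (Fin.le_last _))
    | cast i =>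
      induction j using Fin.lastCases with
      | last => simp [S, snocM]
      | cast j =>
        simp only [S, Matrix.of_apply, snocM_castSucc, Fin.snoc_castSucc]
        apply hA
        exact hij
  have hdec := tri_decomp hlm.le A hA
  have hSR : snocM A u = S * R := by
    ext i c
    rw [Matrix.mul_apply, Fin.sum_univ_castSucc]
    induction i using Fin.lastCases with
    | cast i =>
      simp only [S, R, Matrix.of_apply, snocM_castSucc, Fin.snoc_castSucc, snocM_last, Fin.snoc_last, zero_mul, add_zero]
      conv_lhs => rw [hdec]
      rfl
    | last =>
      simp only [S, R, Matrix.of_apply, snocM_castSucc, Fin.snoc_castSucc, snocM_last, Fin.snoc_last, one_mul]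
      simp only [Emat, Matrix.submatrix_apply, Matrix.one_apply, id]
      by_cases hc : (c : ℕ) < l
      · rw [if_pos hc, add_zero, Finset.sum_eq_single ⟨c, hc⟩]
        · have : Fin.castLE hlm.le ⟨c, hc⟩ = c := by ext; simp
          simp [this]
        · intro b _ hb
          have : Fin.castLE hlm.le b ≠ c := by
            intro hh; apply hb; ext; simp [← hh]
          simp [this]
        · simp
      · rw [if_neg hc, Finset.sum_eq_zero, zero_add]
        intro b _
        have : Fin.castLE hlm.le b ≠ c := by
          intro hh; apply hc; simp [← hh]
        simp [this]
  have hRR : R * Rᴴ = Matrix.diagonal (Fin.snoc (fun _ : Fin l => (1 : ℂ))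
      (((∑ k : Fin (m - l), ‖u ⟨l + k, by omega⟩‖ ^ 2 : ℝ)) : ℂ) : Fin (l + 1) → ℂ) := by
    ext i j
    rw [Matrix.mul_apply]
    simp only [Matrix.conjTranspose_apply]
    induction i using Fin.lastCases with
    | cast i =>
      induction j using Fin.lastCases with
      | cast j =>
        have := congrFun (congrFun (Emat_self l m hlm.le) i) j
        rw [Matrix.mul_apply] at this
        simp only [R, Matrix.of_apply, snocM_castSucc, Fin.snoc_castSucc]
        simp only [Matrix.conjTranspose_apply] at this
        rw [this]
        simp [Matrix.diagonal_apply, Matrix.one_apply]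
      | last =>
        simp only [R, Matrix.of_apply, snocM_castSucc, Fin.snoc_castSucc, snocM_last, Fin.snoc_last]
        rw [Matrix.diagonal_apply_ne _ (Fin.castSucc_lt_last i).ne]
        simp [Emat, Matrix.one_apply]
    | last =>
      induction j using Fin.lastCases with
      | cast j =>
        simp only [R, Matrix.of_apply, snocM_castSucc, Fin.snoc_castSucc, snocM_last, Fin.snoc_last]
        rw [Matrix.diagonal_apply_ne _ (Fin.castSucc_lt_last j).ne']
        simp [Emat, Matrix.one_apply]
      | last =>
        simp only [R, Matrix.of_apply, snocM_last, Fin.snoc_last, Matrix.diagonal_apply_eq]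
        push_cast
        symm
        refine Finset.sum_of_injOn (fun k : Fin (m - l) => (⟨l + k, by omega⟩ : Fin m)) ?_ ?_ ?_ ?_
        · intro a _ b _ hab
          ext
          simpa using hab
        · intro _ _; simp
        · intro c _ hc
          have : (c : ℕ) < l := by
            by_contra hcl
            exact hc ⟨⟨c - l, by omega⟩, by simp, by ext; simp; omega⟩
          simp [this]
        · intro k _
          simp [Complex.mul_conj, Complex.normSq_eq_norm_sq]
  have hDR : D R (l + 1) = ∑ k : Fin (m - l), ‖u ⟨l + k, by omega⟩‖ ^ 2 := by
    rw [D, hRR, pminor_eq _ le_rfl]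
    have : (Fin.castLE (le_refl (l + 1))) = id := by ext; simp
    rw [this, Matrix.submatrix_id_id, Matrix.det_diagonal, Fin.prod_univ_castSucc]
    simp only [snocM_castSucc, Fin.snoc_castSucc, snocM_last, Fin.snoc_last, Finset.prod_const_one, one_mul, Complex.ofReal_re]
  have hDS : D S (l + 1) = D A l := by
    have h1 := D_tri' S hS (1 : Matrix (Fin (l + 1)) (Fin (l + 1)) ℂ) le_rfl
    rw [Matrix.mul_one, D_of_one (1 : Matrix (Fin (l + 1)) (Fin (l + 1)) ℂ) (by simp) le_rfl, mul_one] at h1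
    have hT : ∀ i j : Fin l, i < j → (A.submatrix id (Fin.castLE hlm.le)) i j = 0 := by
      intro i j hij
      exact hA _ _ hij
    have h2 := D_tri' (A.submatrix id (Fin.castLE hlm.le)) hT (Emat l m hlm.le) le_rfl
    rw [← hdec, D_of_one _ (Emat_self l m hlm.le) le_rfl, mul_one] at h2
    rw [h1, h2]
    have e1 : (Fin.castLE (le_refl (l + 1))) = id := by ext; simp
    have e2 : (Fin.castLE (le_refl l)) = id := by ext; simp
    rw [e1, e2, Matrix.submatrix_id_id, Matrix.submatrix_id_id,
      Matrix.det_of_isLowerTriangular S (fun i j hij => hS i j hij),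
      Matrix.det_of_isLowerTriangular _ (fun i j hij => hT i j hij),
      Fin.prod_univ_castSucc]
    simp [S, snocM]
  rw [hSR, D_tri S hS R le_rfl, hDS, hDR]

lemma snoc_exists {l m : ℕ} (hlm : l < m) (A : Matrix (Fin l) (Fin m) ℂ) :
    ∃ U ∈ Matrix.unitaryGroup (Fin m) ℂ, ∀ v : Fin m → ℂ,
      D (snocM A v) (l + 1) =
        D A l * ∑ k : Fin (m - l), ‖(v ᵥ* U) ⟨l + k, by omega⟩‖ ^ 2 := by
  obtain ⟨U, hU, hA⟩ := exists_unitary hlm.le A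
  refine ⟨U, hU, fun v => ?_⟩
  rw [← D_mul_unitary A U hU, ← snoc_core hlm _ hA, ← D_mul_unitary _ U hU]
  congr 1
  ext i c
  induction i using Fin.lastCases with
  | cast i => 
    simp only [Matrix.mul_apply, Matrix.of_apply, snocM_castSucc, Fin.snoc_castSucc]
  | last =>
    simp only [Matrix.mul_apply, Matrix.of_apply, snocM_last, Fin.snoc_last]
    rfl

lemma continuous_D {l m : ℕ} {j : ℕ} (h : j ≤ l) :
    Continuous (fun A : Matrix (Fin l) (Fin m) ℂ => D A j) := by
  simp only [D_eq _ h, rows]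
  refine Complex.continuous_re.comp (Continuous.matrix_det ?_)
  fun_prop

lemma mp_integral {α β : Type*} [MeasurableSpace α] [MeasurableSpace β] {μ : Measure α}
    {ν : Measure β} {f : α → β} (hf : MeasurePreserving f μ ν) (g : β → ℂ) (hg : Measurable g) :
    ∫ x, g (f x) ∂μ = ∫ y, g y ∂ν := by
  rw [← hf.map_eq, integral_map hf.aemeasurable hg.aestronglyMeasurable]

instance matBorel (l m : ℕ) : BorelSpace (Matrix (Fin l) (Fin m) ℂ) :=
  inferInstanceAs (BorelSpace (Fin l → Fin m → ℂ))

lemma measurable_D {l m : ℕ} {j : ℕ} (h : j ≤ l) :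
    Measurable (fun A : Matrix (Fin l) (Fin m) ℂ => D A j) :=
  (continuous_D h).measurable

lemma continuous_snocM {l m : ℕ} :
    Continuous (fun p : (Fin m → ℂ) × Matrix (Fin l) (Fin m) ℂ => snocM p.2 p.1) := by
  refine continuous_matrix fun i c => ?_
  induction i using Fin.lastCases with
  | last => simp only [snocM_last]; fun_prop
  | cast i => simp only [snocM_castSucc]; fun_prop

/-- product of powers of ratios of successive Gram minors -/
def H (a : ℕ → ℂ) {l m : ℕ} (n : ℕ) (A : Matrix (Fin l) (Fin m) ℂ) : ℂ :=
  ∏ j ∈ range n, gp (a j) (D A (j + 1) / D A j)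

/-- product of powers of Gram minors -/
def FF (a : ℕ → ℂ) {l m : ℕ} (n : ℕ) (A : Matrix (Fin l) (Fin m) ℂ) : ℂ :=
  ∏ j ∈ range n, gp (a j) (D A (j + 1))

lemma measurable_H (a : ℕ → ℂ) {l m n : ℕ} (h : n ≤ l) :
    Measurable (fun A : Matrix (Fin l) (Fin m) ℂ => H a n A) := by
  unfold H
  refine Finset.measurable_prod _ fun j hj => ?_
  have hj := Finset.mem_range.1 hj
  exact (measurable_gp _).comp ((measurable_D (by omega)).div (measurable_D (by omega)))

lemma measurable_FF (a : ℕ → ℂ) {l m n : ℕ} (h : n ≤ l) :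
    Measurable (fun A : Matrix (Fin l) (Fin m) ℂ => FF a n A) := by
  unfold FF
  refine Finset.measurable_prod _ fun j hj => ?_
  have hj := Finset.mem_range.1 hj
  exact (measurable_gp _).comp (measurable_D (by omega))

lemma H_eq_zero (a : ℕ → ℂ) {l m n : ℕ} (A : Matrix (Fin l) (Fin m) ℂ) (h : D A n = 0) :
    H a n A = 0 := by
  cases n with
  | zero => rw [D_zero] at h; exact absurd h one_ne_zero
  | succ n =>
    unfold H
    rw [Finset.prod_range_succ, h, zero_div, gp_zero, mul_zero]

lemma D_succ_zero {l m n : ℕ} (hlm : l ≤ m) (hn : n < l) (A : Matrix (Fin l) (Fin m) ℂ)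
    (h : D A n = 0) : D A (n + 1) = 0 := by
  have hn1 : n + 1 ≤ l := hn
  have e1 : D A (n + 1) = D (rows A hn1) (n + 1) := by
    rw [D_eq A hn1, D_eq _ le_rfl]; rfl
  have e2 : rows A hn1 = snocM (rows A hn.le) (A ⟨n, hn⟩) := by
    ext i c
    induction i using Fin.lastCases with
    | last => rw [snocM_last]; rfl
    | cast i => rw [snocM_castSucc]; rfl
  have e3 : D (rows A hn.le) n = D A n := by
    rw [D_eq A hn.le, D_eq _ le_rfl]; rfl
  obtain ⟨U, -, hU⟩ := snoc_exists (lt_of_lt_of_le hn hlm) (rows A hn.le)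
  rw [e1, e2, hU, e3, h, zero_mul]

lemma H_eq_FF (a : ℕ → ℂ) {l m : ℕ} (hlm : l ≤ m) (A : Matrix (Fin l) (Fin m) ℂ) (n : ℕ)
    (hn : n ≤ l) :
    H a n A = FF (fun j => a j - a (j + 1)) n A * gp (a n) (D A n) := by
  induction n with
  | zero => simp [H, FF, D_zero, gp_one]
  | succ n ih =>
    have ih := ih (by omega)
    have h1 : H a (n + 1) A = H a n A * gp (a n) (D A (n + 1) / D A n) := by
      simp [H, Finset.prod_range_succ]
    have h2 : FF (fun j => a j - a (j + 1)) (n + 1) A =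
      FF (fun j => a j - a (j + 1)) n A * gp (a n - a (n + 1)) (D A (n + 1)) := by
      simp [FF, Finset.prod_range_succ]
    rw [h1, h2, ih, mul_assoc, mul_assoc, ← gp_add, ← gp_mul, sub_add_cancel]
    by_cases h0 : D A n = 0
    · rw [h0, D_succ_zero hlm (by omega) A h0]; simp
    · rw [mul_div_cancel₀ _ h0]

lemma H_eq_FF' (a : ℕ → ℂ) {l m : ℕ} (hl : 1 ≤ l) (hlm : l ≤ m) (A : Matrix (Fin l) (Fin m) ℂ)
    (hal : a l = 0) :
    H a l A = FF (fun j => a j - a (j + 1)) l A := by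
  rw [H_eq_FF a hlm A l le_rfl]
  obtain ⟨k, rfl⟩ : ∃ k, l = k + 1 := ⟨l - 1, by omega⟩
  simp only [FF, Finset.prod_range_succ]
  rw [mul_assoc, ← gp_add, hal, add_zero]

lemma H_snoc (a : ℕ → ℂ) {l m : ℕ} (A : Matrix (Fin l) (Fin m) ℂ) (v : Fin m → ℂ) :
    H a (l + 1) (snocM A v) = H a l A * gp (a l) (D (snocM A v) (l + 1) / D A l) := by
  unfold H
  rw [Finset.prod_range_succ, D_snoc_lower A v le_rfl]
  congr 1
  refine Finset.prod_congr rfl fun j hj => ?_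
  have hj := Finset.mem_range.1 hj
  rw [D_snoc_lower A v hj.le, D_snoc_lower A v hj]

lemma row_integral {l m : ℕ} (hlm : l < m) (A : Matrix (Fin l) (Fin m) ℂ) (hA : D A l ≠ 0)
    (a : ℂ) (ha : 0 ≤ a.re) :
    ∫ v, gp a (D (snocM A v) (l + 1) / D A l) ∂(γ (Fin m)) =
      Complex.Gamma ((m - l : ℕ) + a) / Complex.Gamma ((m - l : ℕ)) := by
  obtain ⟨U, hU, h⟩ := snoc_exists hlm A
  have h1 : ∀ v, D (snocM A v) (l + 1) / D A l =
      ∑ k : Fin (m - l), ‖(v ᵥ* U) ⟨l + k, by omega⟩‖ ^ 2 := by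
    intro v; rw [h v, mul_div_cancel_left₀ _ hA]
  simp only [h1]
  have hne : Nonempty (Fin (m - l)) := ⟨⟨0, by omega⟩⟩
  have hr := radial (Fin (m - l)) a ha
  rw [Fintype.card_fin] at hr
  rw [← hr]
  have mp := (γ_restrict (ι := Fin m) (fun k : Fin (m - l) => (⟨l + k, by omega⟩ : Fin m))
    (by intro a b hab; ext; simpa using hab)).comp (γ_unitary U hU)
  exact mp_integral mp (fun u : Fin (m - l) → ℂ => gp a (∑ k, ‖u k‖ ^ 2))
    ((measurable_gp a).comp (by fun_prop))

lemma Gamma_ratio_ne {n : ℕ} (hn : 0 < n) (a : ℂ) (ha : 0 ≤ a.re) :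
    Complex.Gamma (n + a) / Complex.Gamma n ≠ 0 := by
  have : (0 : ℝ) < n := by exact_mod_cast hn
  refine div_ne_zero (Complex.Gamma_ne_zero_of_re_pos ?_) (Complex.Gamma_ne_zero_of_re_pos ?_)
  · simp; linarith
  · simpa using hn

/-- Gaussian matrices -/
def Γm (l m : ℕ) : Measure (Fin l → Fin m → ℂ) := Measure.pi fun _ => γ (Fin m)

instance (l m : ℕ) : IsProbabilityMeasure (Γm l m) := by unfold Γm; infer_instance

theorem gauss_H (m : ℕ) (a : ℕ → ℂ) (l : ℕ) (hlm : l ≤ m) (ha : ∀ j < l, 0 ≤ (a j).re) :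
    Integrable (fun A : Fin l → Fin m → ℂ => H a l (Matrix.of A)) (Γm l m) ∧
    ∫ A : Fin l → Fin m → ℂ, H a l (Matrix.of A) ∂(Γm l m) =
      ∏ j ∈ range l, Complex.Gamma ((m - j : ℕ) + a j) / Complex.Gamma ((m - j : ℕ)) := by
  induction l with
  | zero => simp [H]
  | succ l ih =>
    obtain ⟨ih1, ih2⟩ := ih (by omega) (fun j hj => ha j (by omega))
    have hlm' : l < m := hlm
    have hal := ha l (by omega)
    let h : (Fin m → ℂ) × (Fin l → Fin m → ℂ) → ℂ :=
      fun p => H a (l + 1) (snocM (Matrix.of p.2) p.1)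
    have hmeas : Measurable h := by
      have h1 : Measurable (fun p : (Fin m → ℂ) × (Fin l → Fin m → ℂ) =>
        snocM (Matrix.of p.2) p.1) := (continuous_snocM (l := l) (m := m)).measurable
      exact (measurable_H a le_rfl).comp h1
    have hh : ∀ v A, h (v, A) = H a l (Matrix.of A) *
        gp (a l) (D (snocM (Matrix.of A) v) (l + 1) / D (Matrix.of A) l) :=
      fun v A => H_snoc a (Matrix.of A) v
    set c : ℂ := Complex.Gamma ((m - l : ℕ) + a l) / Complex.Gamma ((m - l : ℕ)) with hc
    set c' : ℝ := (Complex.Gamma ((m - l : ℕ) + ((a l).re : ℂ)) / Complex.Gamma ((m - l : ℕ))).re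
    have hint : ∀ A, ∫ v, h (v, A) ∂(γ (Fin m)) = H a l (Matrix.of A) * c := by
      intro A
      simp only [hh]
      rw [integral_const_mul]
      by_cases h0 : D (Matrix.of A) l = 0
      · rw [H_eq_zero a _ h0]; simp
      · rw [row_integral hlm' _ h0 _ hal]
    have hintn : ∀ A, ∫ v, ‖h (v, A)‖ ∂(γ (Fin m)) = ‖H a l (Matrix.of A)‖ * c' := by
      intro A
      simp only [hh, norm_mul]
      rw [integral_const_mul]
      by_cases h0 : D (Matrix.of A) l = 0
      · rw [H_eq_zero a _ h0]; simp
      · congr 1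
        have := row_integral hlm' _ h0 ((a l).re : ℂ) (by simpa using hal)
        simp only [← norm_gp] at this
        rw [integral_complex_ofReal] at this
        rw [← Complex.ofReal_re (∫ v, _ ∂_), this]
    have hi : Integrable h ((γ (Fin m)).prod (Γm l m)) := by
      rw [integrable_prod_iff' hmeas.aestronglyMeasurable]
      refine ⟨ae_of_all _ fun A => ?_, ?_⟩
      · simp only [hh]
        by_cases h0 : D (Matrix.of A) l = 0
        · rw [H_eq_zero a _ h0]; simp
        · refine Integrable.const_mul (.of_integral_ne_zero ?_) _
          rw [row_integral hlm' _ h0 _ hal]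
          exact Gamma_ratio_ne (by omega) _ hal
      · simp only [hintn]
        exact ih1.norm.mul_const _
    have mp := measurePreserving_piFinSuccAbove (fun _ : Fin (l + 1) => γ (Fin m)) (Fin.last l)
    set e := MeasurableEquiv.piFinSuccAbove (fun _ : Fin (l + 1) => Fin m → ℂ) (Fin.last l)
    have hHe : ∀ A : Fin (l + 1) → Fin m → ℂ, H a (l + 1) (Matrix.of A) = h (e A) := by
      intro A
      simp only [h]
      congr 1
      ext i k
      induction i using Fin.lastCases with
      | last => rw [snocM_last]; rfl
      | cast i => 
        rw [snocM_castSucc]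
        simp [e, MeasurableEquiv.piFinSuccAbove]
        rfl
    constructor
    · simp only [hHe]
      exact (mp.integrable_comp_emb e.measurableEmbedding).2 hi
    · simp only [hHe]
      have : ∫ A, h (e A) ∂(Γm (l + 1) m) = ∫ p, h p ∂((γ (Fin m)).prod (Γm l m)) :=
        mp.integral_comp e.measurableEmbedding h
      rw [this, integral_prod_symm _ hi]
      simp only [hint]
      rw [integral_mul_const, ih2, Finset.prod_range_succ]

instance matSC (l m : ℕ) : SecondCountableTopology (Matrix (Fin l) (Fin m) ℂ) :=
  inferInstanceAs (SecondCountableTopology (Fin l → Fin m → ℂ))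

lemma haar_mp {M : ℕ} {μ : Measure (Matrix (Fin M) (Fin M) ℂ)} (h : IsHaarUnitary M μ)
    {U : Matrix (Fin M) (Fin M) ℂ} (hU : U ∈ Matrix.unitaryGroup (Fin M) ℂ) :
    MeasurePreserving (fun A => U * A) μ μ :=
  ⟨(by fun_prop : Continuous (fun A : Matrix (Fin M) (Fin M) ℂ => U * A)).measurable, h.2.2 U hU⟩

lemma haar_ae {M : ℕ} {μ : Measure (Matrix (Fin M) (Fin M) ℂ)} (h : IsHaarUnitary M μ) :
    ∀ᵐ k ∂μ, k ∈ Matrix.unitaryGroup (Fin M) ℂ := by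
  rw [ae_iff]; exact h.2.1

lemma continuous_tlb (l m M : ℕ) (hl : l ≤ M) (hm : m ≤ M) :
    Continuous (topLeftBlock l m M hl hm) := by
  unfold topLeftBlock
  refine continuous_matrix fun i c => ?_
  simp only [Matrix.of_apply]
  fun_prop

lemma exists_bd {l M : ℕ} (hl : l ≤ M) (κ : Matrix (Fin l) (Fin l) ℂ)
    (hκ : κ ∈ Matrix.unitaryGroup (Fin l) ℂ) :
    ∃ U ∈ Matrix.unitaryGroup (Fin M) ℂ, ∀ (m : ℕ) (hm : m ≤ M) (K : Matrix (Fin M) (Fin M) ℂ),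
      κ * topLeftBlock l m M hl hm K = topLeftBlock l m M hl hm (U * K) := by
  obtain ⟨d, rfl⟩ := Nat.exists_eq_add_of_le hl
  have hκ' : κ * κᴴ = 1 := (Matrix.mem_unitaryGroup_iff).1 hκ
  refine ⟨(Matrix.fromBlocks κ 0 0 1).submatrix finSumFinEquiv.symm finSumFinEquiv.symm, ?_, ?_⟩
  · rw [Matrix.mem_unitaryGroup_iff, Matrix.star_eq_conjTranspose, Matrix.conjTranspose_submatrix,
      Matrix.submatrix_mul_equiv, Matrix.fromBlocks_conjTranspose, Matrix.fromBlocks_multiply]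
    simp [hκ']
  · intro m hm K
    ext i c
    have hc : ∀ i : Fin l, Fin.castLE hl i = Fin.castAdd d i := fun i => rfl
    simp [topLeftBlock, Matrix.mul_apply, Fin.sum_univ_add, hc]

lemma D_bound {l m M : ℕ} (hl : l ≤ M) (hm : m ≤ M) (j : ℕ) (hj : j ≤ l) :
    ∃ C : ℝ, ∀ K ∈ Matrix.unitaryGroup (Fin M) ℂ, |D (topLeftBlock l m M hl hm K) j| ≤ C := by
  refine ⟨(Nat.factorial (Fintype.card (Fin j))) • (m : ℝ) ^ (Fintype.card (Fin j)), fun K hK => ?_⟩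
  rw [D_eq _ hj]
  refine (Complex.abs_re_le_norm _).trans ?_
  refine Matrix.det_le (abv := (NormedField.toAbsoluteValue ℂ)) (x := (m : ℝ)) ?_
  intro p q
  change ‖(_ : ℂ)‖ ≤ _
  rw [Matrix.mul_apply]
  refine (norm_sum_le _ _).trans ?_
  have : ∀ i ∈ (Finset.univ : Finset (Fin m)),
      ‖rows (topLeftBlock l m M hl hm K) hj p i * (rows (topLeftBlock l m M hl hm K) hj)ᴴ i q‖
        ≤ 1 := by
    intro i _
    rw [norm_mul, Matrix.conjTranspose_apply, norm_star]
    exact mul_le_one₀ (entry_norm_bound_of_unitary hK _ _) (norm_nonneg _)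
      (entry_norm_bound_of_unitary hK _ _)
  refine (Finset.sum_le_sum this).trans ?_
  simp

lemma FF_bound (a : ℕ → ℂ) {l m M : ℕ} (hl : l ≤ M) (hm : m ≤ M) (ha : ∀ j < l, 0 ≤ (a j).re) :
    ∃ C : ℝ, ∀ K ∈ Matrix.unitaryGroup (Fin M) ℂ, ‖FF a l (topLeftBlock l m M hl hm K)‖ ≤ C := by
  have h : ∀ j, ∃ C : ℝ, j < l → ∀ K ∈ Matrix.unitaryGroup (Fin M) ℂ,
      ‖gp (a j) (D (topLeftBlock l m M hl hm K) (j + 1))‖ ≤ C := by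
    intro j
    by_cases hj : j < l
    · obtain ⟨C, hC⟩ := D_bound (l := l) (m := m) (M := M) hl hm (j + 1) hj
      exact ⟨_, fun _ K hK => norm_gp_le _ (ha j hj) _ C (hC K hK)⟩
    · exact ⟨0, fun h => absurd h hj⟩
  choose C hC using h
  refine ⟨∏ j ∈ range l, C j, fun K hK => ?_⟩
  unfold FF
  rw [norm_prod]
  exact Finset.prod_le_prod (fun _ _ => norm_nonneg _)
    fun j hj => hC j (Finset.mem_range.1 hj) K hK

/-- averaging over the small unitary group changes nothing -/
lemma step2 (a : ℕ → ℂ) {l m M : ℕ} (hl : l ≤ M) (hm : m ≤ M) (ha : ∀ j < l, 0 ≤ (a j).re)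
    (μl : Measure (Matrix (Fin l) (Fin l) ℂ)) (hμl : IsHaarUnitary l μl)
    (μM : Measure (Matrix (Fin M) (Fin M) ℂ)) (hμM : IsHaarUnitary M μM) :
    ∫ K, ∫ κ, FF a l (κ * topLeftBlock l m M hl hm K) ∂μl ∂μM =
      ∫ K, FF a l (topLeftBlock l m M hl hm K) ∂μM := by
  have := hμl.1
  have := hμM.1
  obtain ⟨C, hC⟩ := FF_bound a (m := m) hl hm ha
  have hcont := continuous_tlb l m M hl hm
  have hint : Integrable (Function.uncurry fun K κ => FF a l (κ * topLeftBlock l m M hl hm K))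
      (μM.prod μl) := by
    refine Integrable.of_bound (C := C) ?_ ?_
    · have h1 : Continuous (fun p : Matrix (Fin M) (Fin M) ℂ × Matrix (Fin l) (Fin l) ℂ =>
        p.2 * topLeftBlock l m M hl hm p.1) := by fun_prop
      exact ((measurable_FF a le_rfl).comp h1.measurable).aestronglyMeasurable
    · have h1 := Measure.quasiMeasurePreserving_fst (μ := μM) (ν := μl) |>.ae (haar_ae hμM)
      have h2 := Measure.quasiMeasurePreserving_snd (μ := μM) (ν := μl) |>.ae (haar_ae hμl)
      filter_upwards [h1, h2] with p hp1 hp2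
      obtain ⟨U, hU, h⟩ := exists_bd hl p.2 hp2
      simp only [Function.uncurry]
      rw [h]
      exact hC _ (mul_mem hU hp1)
  rw [integral_integral_swap hint]
  have : ∀ᵐ κ ∂μl, ∫ K, FF a l (κ * topLeftBlock l m M hl hm K) ∂μM =
      ∫ K, FF a l (topLeftBlock l m M hl hm K) ∂μM := by
    filter_upwards [haar_ae hμl] with κ hκ
    obtain ⟨U, hU, h⟩ := exists_bd hl κ hκ
    simp only [h]
    exact mp_integral (haar_mp hμM hU) (fun K => FF a l (topLeftBlock l m M hl hm K))
      ((measurable_FF a le_rfl).comp hcont.measurable)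
  rw [integral_congr_ae this]
  simp

/-- first `m` columns -/
def cols {l M : ℕ} (m : ℕ) (hm : m ≤ M) (A : Matrix (Fin l) (Fin M) ℂ) : Matrix (Fin l) (Fin m) ℂ :=
  A.submatrix id (Fin.castLE hm)

lemma cols_mul {l n M : ℕ} (m : ℕ) (hm : m ≤ M) (A : Matrix (Fin l) (Fin n) ℂ)
    (B : Matrix (Fin n) (Fin M) ℂ) : cols m hm (A * B) = A * cols m hm B := by
  ext i j; simp [cols, Matrix.mul_apply]

lemma cols_mp {l m M : ℕ} (hm : m ≤ M) (k : Matrix (Fin M) (Fin M) ℂ)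
    (hk : k ∈ Matrix.unitaryGroup (Fin M) ℂ) :
    MeasurePreserving (fun A : Fin l → Fin M → ℂ =>
      (fun i j => cols m hm (Matrix.of A * k) i j : Fin l → Fin m → ℂ)) (Γm l M) (Γm l m) := by
  have h := (γ_restrict (ι := Fin M) (fun j : Fin m => Fin.castLE hm j)
    (Fin.castLE_injective hm)).comp (γ_unitary k hk)
  unfold Γm
  have := measurePreserving_pi (fun _ : Fin l => γ (Fin M)) (fun _ : Fin l => γ (Fin m))
    (fun _ => h)
  exact this

lemma haar_avg (a : ℕ → ℂ) {l m M : ℕ} (hl : l ≤ M) (hm : m ≤ M)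
    (μM : Measure (Matrix (Fin M) (Fin M) ℂ)) (hμM : IsHaarUnitary M μM)
    (A : Matrix (Fin l) (Fin M) ℂ) :
    ∫ k, FF a l (cols m hm (A * k)) ∂μM =
      FF a l A * ∫ K, FF a l (topLeftBlock l m M hl hm K) ∂μM := by
  obtain ⟨U, hU, hA⟩ := exists_unitary hl A
  have hUs : Uᴴ ∈ Matrix.unitaryGroup (Fin M) ℂ := Unitary.star_mem hU
  have hUU : U * Uᴴ = 1 := (Matrix.mem_unitaryGroup_iff).1 hU
  have htd := tri_decomp hl (A * U) hA
  set T := (A * U).submatrix id (Fin.castLE hl) with hT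
  have hTri : ∀ i j, i < j → T i j = 0 := fun i j hij => hA i _ hij
  have hFA : FF a l A = FF a l T := by
    unfold FF
    refine Finset.prod_congr rfl fun j hj => ?_
    have hj : j + 1 ≤ l := Finset.mem_range.1 hj
    rw [← D_mul_unitary A U hU, htd, D_tri T hTri _ hj, D_of_one _ (Emat_self l M hl) hj, mul_one]
  have hk : ∀ k, FF a l (cols m hm (A * k)) =
      FF a l A * FF a l (topLeftBlock l m M hl hm (Uᴴ * k)) := by
    intro k
    have h1 : cols m hm (A * k) = T * topLeftBlock l m M hl hm (Uᴴ * k) := by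
      have h2 : A * k = T * (Emat l M hl * (Uᴴ * k)) := by
        rw [← Matrix.mul_assoc, ← htd, Matrix.mul_assoc A, ← Matrix.mul_assoc U, hUU,
          Matrix.one_mul]
      rw [h2, cols_mul, Emat_mul]
      rfl
    rw [h1, hFA]
    unfold FF
    rw [← Finset.prod_mul_distrib]
    refine Finset.prod_congr rfl fun j hj => ?_
    have hj : j + 1 ≤ l := Finset.mem_range.1 hj
    rw [D_tri T hTri _ hj, gp_mul]
  simp only [hk]
  rw [integral_const_mul]
  congr 1
  exact mp_integral (haar_mp hμM hUs) (fun K => FF a l (topLeftBlock l m M hl hm K))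
      ((measurable_FF a le_rfl).comp (continuous_tlb l m M hl hm).measurable)

lemma step3 (a : ℕ → ℂ) {l m M : ℕ} (hl : l ≤ M) (hm : m ≤ M)
    (μM : Measure (Matrix (Fin M) (Fin M) ℂ)) (hμM : IsHaarUnitary M μM)
    (hi : Integrable (fun A : Fin l → Fin m → ℂ => FF a l (Matrix.of A)) (Γm l m)) :
    ∫ A, FF a l (Matrix.of A) ∂(Γm l m) =
      (∫ A, FF a l (Matrix.of A) ∂(Γm l M)) * ∫ K, FF a l (topLeftBlock l m M hl hm K) ∂μM := by
  have := hμM.1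
  let f : Matrix (Fin M) (Fin M) ℂ → (Fin l → Fin M → ℂ) → ℂ :=
    fun k A => FF a l (cols m hm (Matrix.of A * k))
  have hFm : Measurable (fun A : Fin l → Fin m → ℂ => FF a l (Matrix.of A)) :=
    measurable_FF a le_rfl
  have hfm : Measurable (Function.uncurry f) := by
    have h1 : Continuous (fun p : Matrix (Fin M) (Fin M) ℂ × (Fin l → Fin M → ℂ) =>
        cols m hm (Matrix.of p.2 * p.1)) := by
      unfold cols
      refine Continuous.matrix_submatrix ?_ _ _
      refine Continuous.matrix_mul ?_ continuous_fst
      exact continuous_snd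
    exact (measurable_FF a le_rfl).comp h1.measurable
  have hint : Integrable (Function.uncurry f) (μM.prod (Γm l M)) := by
    rw [integrable_prod_iff hfm.aestronglyMeasurable]
    constructor
    · filter_upwards [haar_ae hμM] with k hk
      exact (cols_mp (l := l) hm k hk).integrable_comp_of_integrable hi
    · have : (fun k => ∫ A, ‖f k A‖ ∂(Γm l M)) =ᵐ[μM]
          fun _ => ∫ A, ‖FF a l (Matrix.of A)‖ ∂(Γm l m) := by
        filter_upwards [haar_ae hμM] with k hk
        have mp := cols_mp (l := l) hm k hk
        rw [← mp.map_eq, integral_map mp.aemeasurable hFm.norm.aestronglyMeasurable]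
        rfl
      exact (integrable_congr this).2 (integrable_const _)
  have e1 : ∫ k, ∫ A, f k A ∂(Γm l M) ∂μM = ∫ A, FF a l (Matrix.of A) ∂(Γm l m) := by
    have : ∀ᵐ k ∂μM, ∫ A, f k A ∂(Γm l M) = ∫ A, FF a l (Matrix.of A) ∂(Γm l m) := by
      filter_upwards [haar_ae hμM] with k hk
      exact mp_integral (cols_mp (l := l) hm k hk) _ hFm
    rw [integral_congr_ae this]
    simp
  rw [← e1, integral_integral_swap hint]
  have : ∀ A, ∫ k, f k A ∂μM = FF a l (Matrix.of A) *
      ∫ K, FF a l (topLeftBlock l m M hl hm K) ∂μM :=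
    fun A => haar_avg a hl hm μM hμM (Matrix.of A)
  simp only [this]
  rw [integral_mul_const]

lemma sph_eq (s : ℕ → ℂ) (L : ℕ → ℤ) {l m : ℕ} (A : Matrix (Fin l) (Fin m) ℂ) :
    sphProd l s L (A * Aᴴ) = FF (fun j => s j - sNext l s j - 1) l A := by
  unfold sphProd FF
  refine Finset.prod_congr rfl fun j hj => ?_
  have hj : j + 1 ≤ l := Finset.mem_range.1 hj
  have h0 := D_nonneg A hj
  change (if D A (j + 1) = 0 then 0
    else ((Real.sign (D A (j + 1)) : ℂ) ^ (L j - LNext l L j - 1)) *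
      (((|D A (j + 1)| : ℝ) : ℂ) ^ (s j - sNext l s j - 1))) = _
  unfold gp
  split_ifs with h
  · rfl
  · rw [Real.sign_of_pos (lt_of_le_of_ne h0 (Ne.symm h))]
    simp

lemma FF_congr {a b : ℕ → ℂ} {l m n : ℕ} (h : ∀ j < n, a j = b j) (A : Matrix (Fin l) (Fin m) ℂ) :
    FF a n A = FF b n A := by
  unfold FF
  refine Finset.prod_congr rfl fun j hj => ?_
  rw [h j (Finset.mem_range.1 hj)]

/-- Spherical transform of a truncation of a Haar unitary matrix:
`∫_{U(M)} N_{l,l}(s, L^{(l)}; B(k) B(k)*) dk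
   = ∏_{j=1}^{l} (M−j)! Γ(s_j+m−l+1) / ((m−j)! Γ(s_j+M−l+1))`. -/
theorem statement5 (l m M : ℕ) (hl : 1 ≤ l) (hlm : l ≤ m) (hmM : m ≤ M)
    (s : ℕ → ℂ) (hs : ∀ j < l, 1 ≤ (s j - sNext l s j).re)
    (μl : Measure (Matrix (Fin l) (Fin l) ℂ)) (hμl : IsHaarUnitary l μl)
    (μM : Measure (Matrix (Fin M) (Fin M) ℂ)) (hμM : IsHaarUnitary M μM) :
    (∫ k, Nsph l l μl s (Lstd l)
        (topLeftBlock l m M (hlm.trans hmM) hmM k * (topLeftBlock l m M (hlm.trans hmM) hmM k)ᴴ)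
      ∂μM) =
      ∏ j ∈ Finset.range l,
        ((Nat.factorial (M - (j + 1)) : ℂ) * Complex.Gamma (s j + (m - l : ℕ) + 1)) /
          ((Nat.factorial (m - (j + 1)) : ℂ) * Complex.Gamma (s j + (M - l : ℕ) + 1)) := by
  have hlM := hlm.trans hmM
  let a : ℕ → ℂ := fun j => if j < l then s j - l + j + 1 else 0
  let lam : ℕ → ℂ := fun j => a j - a (j + 1)
  have hal : a l = 0 := by simp [a]
  have hlam : ∀ j < l, s j - sNext l s j - 1 = lam j := by
    intro j hj
    simp only [lam, a, sNext, hj, if_true]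
    by_cases h : j + 1 < l
    · simp only [h, if_true]; push_cast; ring
    · have : l = j + 1 := by omega
      subst this
      simp
      ring
  have hlamre : ∀ j < l, 0 ≤ (lam j).re := by
    intro j hj
    rw [← hlam j hj]
    have := hs j hj
    simp only [Complex.sub_re, Complex.one_re] at this ⊢
    linarith
  have hare : ∀ j < l, 0 ≤ (a j).re := by
    have : ∀ d j, j + d = l → 0 ≤ (a j).re := by
      intro d
      induction d with
      | zero => intro j hj; simp only [add_zero] at hj; subst hj; simp [hal]
      | succ d ih =>
        intro j hj
        have h1 := ih (j + 1) (by omega)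
        have h2 := hlamre j (by omega)
        simp only [lam, Complex.sub_re] at h2
        linarith
    intro j hj
    exact this (l - j) j (by omega)
  have key : ∀ n, l ≤ n → Integrable (fun A : Fin l → Fin n → ℂ => FF lam l (Matrix.of A)) (Γm l n) ∧
      ∫ A : Fin l → Fin n → ℂ, FF lam l (Matrix.of A) ∂(Γm l n) =
      ∏ j ∈ range l, Complex.Gamma ((n - j : ℕ) + a j) / Complex.Gamma ((n - j : ℕ)) := by
    intro n hn
    have := gauss_H n a l hn hare
    simp only [H_eq_FF' a hl hn _ hal] at this
    exact this
  have hL : (∫ k, Nsph l l μl s (Lstd l)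
        (topLeftBlock l m M hlM hmM k * (topLeftBlock l m M hlM hmM k)ᴴ) ∂μM) =
      ∫ K, FF lam l (topLeftBlock l m M hlM hmM K) ∂μM := by
    rw [← step2 lam hlM hmM hlamre μl hμl μM hμM]
    refine integral_congr_ae (ae_of_all _ fun K => ?_)
    simp only [Nsph]
    refine integral_congr_ae (ae_of_all _ fun κ => ?_)
    simp only
    set B := topLeftBlock l m M hlM hmM K
    have : κ * (B * Bᴴ) * κᴴ = (κ * B) * (κ * B)ᴴ := by
      rw [Matrix.conjTranspose_mul]; simp only [Matrix.mul_assoc]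
    rw [this, sph_eq, FF_congr hlam]
  rw [hL]
  have h3 := step3 lam hlM hmM μM hμM (key m hlm).1
  rw [(key m hlm).2, (key M hlM).2] at h3
  have hne : ∏ j ∈ range l, Complex.Gamma ((M - j : ℕ) + a j) / Complex.Gamma ((M - j : ℕ)) ≠ 0 := by
    refine Finset.prod_ne_zero_iff.2 fun j hj => ?_
    have hj := Finset.mem_range.1 hj
    exact Gamma_ratio_ne (by omega) _ (hare j hj)
  rw [← mul_right_inj' hne, ← h3, ← Finset.prod_mul_distrib]
  refine Finset.prod_congr rfl fun j hj => ?_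
  have hj := Finset.mem_range.1 hj
  have hG : ∀ n, l ≤ n → Complex.Gamma ((n - j : ℕ) + a j) = Complex.Gamma (s j + (n - l : ℕ) + 1) ∧
      Complex.Gamma ((n - j : ℕ)) = (Nat.factorial (n - (j + 1)) : ℂ) := by
    intro n hn
    constructor
    · congr 1
      simp only [a, hj, if_true]
      rw [Nat.cast_sub (by omega), Nat.cast_sub hn]
      ring
    · rw [← Complex.Gamma_nat_eq_factorial]
      congr 1
      have : n - j = (n - (j + 1)) + 1 := by omega
      rw [this]; push_cast; rfl
  have h1 := Gamma_ratio_ne (n := M - j) (by omega) (a j) (hare j hj)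
  rw [(hG m hlm).1, (hG m hlm).2, (hG M hlM).1, (hG M hlM).2]
  rw [(hG M hlM).1, (hG M hlM).2] at h1
  have h4 := (div_ne_zero_iff.1 h1).1
  have h5 := (div_ne_zero_iff.1 h1).2
  have h6 : (Nat.factorial (m - (j + 1)) : ℂ) ≠ 0 := by exact_mod_cast Nat.factorial_ne_zero _
  field_simp

end RMT
end
end

section
/- Let n ≥ 1, let P: ℂ^{n×n} → ℝ be Lebesgue-integrable with P(u g v) = P(g) for all u, v ∈ U(n) and all g, and let Q: Herm_n → ℝ be Lebesgue-integrable on the n×n Hermitian matrices with Q(u x u*) = Q(x) for all u ∈ U(n) and all x. Let s ∈ ℂ^n with Re(s_j − s_{j+1}) ≥ 1 for j = 1,…,n (convention s_{n+1} = −1) and L ∈ {0,1}^n, and assume the absolute-integrability condition ∫_{Herm_n} ∫_{ℂ^{n×n}} N^{abs}_{n,n}(Re s; g x g*) |P(g)| |Q(x)| dg dx < ∞ as well as ∫ N^{abs}_{n,n}(Re s; g g*)|P(g)| dg < ∞ and ∫ N^{abs}_{n,n}(Re s; x)|Q(x)| dx < ∞. Then the spherical transform of the multiplicative convolution factorizes: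 ∫_{Herm_n} ∫_{ℂ^{n×n}} N_{n,n}(s, L; g x g*) P(g) Q(x) dg dx = ( ∫_{ℂ^{n×n}} N_{n,n}(s, L^{(n)}; g g*) P(g) dg ) · ( ∫_{Herm_n} N_{n,n}(s, L; x) Q(x) dx ). -/
open MeasureTheory Matrix Finset Filter

noncomputable section

namespace RMT

/-- Coordinates for the space `Herm_n` of `n × n` Hermitian matrices: the real diagonal
entries and the strictly upper-triangular complex entries. The flat Lebesgue measure on
`Herm_n` is the volume measure on this coordinate space. -/
abbrev HermCoords (n : ℕ) : Type := (Fin n → ℝ) × ({p : Fin n × Fin n // p.1 < p.2} → ℂ)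

/-- The Hermitian matrix with the given coordinates. -/
def hermOfCoords {n : ℕ} (c : HermCoords n) : Matrix (Fin n) (Fin n) ℂ :=
  Matrix.of fun i j =>
    if h : i < j then c.2 ⟨(i, j), h⟩
    else if h' : j < i then starRingEnd ℂ (c.2 ⟨(j, i), h'⟩)
    else ((c.1 i : ℝ) : ℂ)

/-- The (real) integrand of `N^{abs}_{l,n}(σ; ·)`. -/
def absProdR (n : ℕ) (σ : ℕ → ℝ) {l : ℕ} (y : Matrix (Fin l) (Fin l) ℂ) : ℝ :=
  ∏ j ∈ Finset.range n,
    if pminor y (j + 1) = 0 then 0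
    else |pminor y (j + 1)| ^ (σ j - (if j + 1 < n then σ (j + 1) else -1) - 1)

/-- `N^{abs}_{l,n}(σ; x)`. -/
def NabsR (n : ℕ) {l : ℕ} (μ : Measure (Matrix (Fin l) (Fin l) ℂ)) (σ : ℕ → ℝ)
    (x : Matrix (Fin l) (Fin l) ℂ) : ℝ :=
  ∫ k, absProdR n σ (k * x * kᴴ) ∂μ


section aux

/-! ### Triangular factorization and multiplicativity -/

/-- Leading block of a matrix. -/
def lead {n : ℕ} (j : ℕ) (y : Matrix (Fin n) (Fin n) ℂ) :
    Matrix (Fin (min j n)) (Fin (min j n)) ℂ :=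
  Matrix.of fun p q => y (Fin.castLE (min_le_right j n) p) (Fin.castLE (min_le_right j n) q)

lemma pminor_eq_s6 {n : ℕ} (y : Matrix (Fin n) (Fin n) ℂ) (j : ℕ) :
    pminor y j = (lead j y).det.re := rfl

lemma sum_lead {n : ℕ} (j : ℕ) (f : Fin n → ℂ) (hf : ∀ i : Fin n, j ≤ (i : ℕ) → f i = 0) :
    ∑ i, f i = ∑ p : Fin (min j n), f (Fin.castLE (min_le_right j n) p) := by
  classical
  have hinj : Function.Injective (Fin.castLE (min_le_right j n)) := Fin.castLE_injective _
  rw [← Finset.sum_image (s := Finset.univ) (g := Fin.castLE (min_le_right j n))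
    (f := f) (fun a _ b _ h => hinj h)]
  symm
  apply Finset.sum_subset (Finset.subset_univ _)
  intro i _ hi
  apply hf
  by_contra hlt
  apply hi
  rw [Finset.mem_image]
  exact ⟨⟨i, by have := i.2; omega⟩, Finset.mem_univ _, rfl⟩

lemma lead_conj {n : ℕ} (j : ℕ) (T y : Matrix (Fin n) (Fin n) ℂ)
    (hT : ∀ a b : Fin n, a < b → T a b = 0) :
    lead j (T * y * Tᴴ) = lead j T * lead j y * (lead j T)ᴴ := by
  have key : ∀ (p : Fin (min j n)) (i : Fin n), j ≤ (i : ℕ) →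
      T (Fin.castLE (min_le_right j n) p) i = 0 := by
    intro p i hi
    apply hT
    rw [Fin.lt_def]
    have := p.2
    simp only [Fin.val_castLE]
    omega
  ext p q
  simp only [lead, Matrix.mul_apply, Matrix.of_apply, Matrix.conjTranspose_apply]
  rw [sum_lead j]
  · apply Finset.sum_congr rfl
    intro r _
    congr 1
    rw [sum_lead j]
    intro i hi
    rw [key p i hi, zero_mul]
  · intro i hi
    rw [key q i hi]
    simp

lemma pminor_conj {n : ℕ} (j : ℕ) (T y : Matrix (Fin n) (Fin n) ℂ)
    (hT : ∀ a b : Fin n, a < b → T a b = 0) :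
    pminor (T * y * Tᴴ) j = Complex.normSq (lead j T).det * pminor y j := by
  rw [pminor_eq_s6, pminor_eq_s6, lead_conj j T y hT, Matrix.det_mul, Matrix.det_mul,
    Matrix.det_conjTranspose]
  have : (lead j T).det * (lead j y).det * star (lead j T).det =
      ((Complex.normSq (lead j T).det : ℝ) : ℂ) * (lead j y).det := by
    rw [Complex.normSq_eq_conj_mul_self]
    simp only [Complex.star_def]
    ring
  rw [this, Complex.re_ofReal_mul]

lemma pminor_self {n : ℕ} (j : ℕ) (T : Matrix (Fin n) (Fin n) ℂ)
    (hT : ∀ a b : Fin n, a < b → T a b = 0) :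
    pminor (T * Tᴴ) j = Complex.normSq (lead j T).det := by
  have h := pminor_conj j T 1 hT
  have h1 : pminor (1 : Matrix (Fin n) (Fin n) ℂ) j = 1 := by
    rw [pminor_eq_s6]
    have : lead j (1 : Matrix (Fin n) (Fin n) ℂ) = 1 := by
      ext p q
      simp [lead, Matrix.one_apply, Fin.ext_iff]
    rw [this, Matrix.det_one, Complex.one_re]
  rwa [Matrix.mul_one, h1, mul_one] at h

lemma sphProd_conj {n : ℕ} (s : ℕ → ℂ) (L L' : ℕ → ℤ) (T y : Matrix (Fin n) (Fin n) ℂ)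
    (hT : ∀ a b : Fin n, a < b → T a b = 0) :
    sphProd n s L (T * y * Tᴴ) = sphProd n s L' (T * Tᴴ) * sphProd n s L y := by
  unfold sphProd
  rw [← Finset.prod_mul_distrib]
  apply Finset.prod_congr rfl
  intro j _
  rw [pminor_conj _ T y hT, pminor_self _ T hT]
  have ha : 0 ≤ Complex.normSq (lead (j+1) T).det := Complex.normSq_nonneg _
  generalize Complex.normSq (lead (j+1) T).det = a at ha
  generalize pminor y (j+1) = b
  rcases ha.eq_or_lt with h | h
  · simp [← h]
  · by_cases hb : b = 0
    · simp [hb]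
    · rw [if_neg (mul_ne_zero h.ne' hb), if_neg h.ne', if_neg hb]
      have hsg : Real.sign (a * b) = Real.sign b := by
        rcases lt_or_gt_of_ne hb with hb' | hb'
        · rw [Real.sign_of_neg hb', Real.sign_of_neg (mul_neg_of_pos_of_neg h hb')]
        · rw [Real.sign_of_pos hb', Real.sign_of_pos (mul_pos h hb')]
      rw [hsg, Real.sign_of_pos h, abs_mul, Complex.ofReal_mul,
        Complex.mul_cpow_ofReal_nonneg (abs_nonneg _) (abs_nonneg _)]
      simp only [Complex.ofReal_one, _root_.one_zpow]
      ring

lemma sphProd_eq_zero {n : ℕ} (hn : 1 ≤ n) (s : ℕ → ℂ) (L : ℕ → ℤ)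
    (y : Matrix (Fin n) (Fin n) ℂ) (hy : y.det = 0) : sphProd n s L y = 0 := by
  unfold sphProd
  apply Finset.prod_eq_zero (i := n - 1) (by simp; omega)
  rw [if_pos]
  rw [Nat.sub_add_cancel hn, pminor_eq_s6]
  have h : (lead n y).det = y.det := by
    have : lead n y = y.submatrix (finCongr (min_self n)) (finCongr (min_self n)) := by
      ext p q
      rfl
    rw [this, Matrix.det_submatrix_equiv_self]
  rw [h, hy, Complex.zero_re]

open scoped ComplexOrder in
lemma exists_tri {n : ℕ} (M : Matrix (Fin n) (Fin n) ℂ) (hM : M.det ≠ 0) :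
    ∃ T u : Matrix (Fin n) (Fin n) ℂ, (∀ a b : Fin n, a < b → T a b = 0) ∧
      u ∈ Matrix.unitaryGroup (Fin n) ℂ ∧ M = T * u := by
  have hMu : IsUnit M := (Matrix.isUnit_iff_isUnit_det M).2 (isUnit_iff_ne_zero.2 hM)
  have hS : (M * Mᴴ).PosDef :=
    Matrix.PosDef.mul_conjTranspose_self M (Matrix.vecMul_injective_iff_isUnit.2 hMu)
  have hD : (LDL.diag hS).PosDef := by
    rw [LDL.diag_eq_lowerInv_conj hS]
    exact hS.mul_mul_conjTranspose_same
      (Matrix.vecMul_injective_iff_isUnit.2 (isUnit_of_invertible (LDL.lowerInv hS)))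
  have hd : ∀ i, 0 < LDL.diagEntries hS i := by
    intro i
    have := hD.diag_pos (i := i)
    simpa [LDL.diag] using this
  let E : Matrix (Fin n) (Fin n) ℂ :=
    Matrix.diagonal fun i => ((Real.sqrt (LDL.diagEntries hS i).re : ℝ) : ℂ)
  have hE : E * Eᴴ = LDL.diag hS := by
    simp only [E, Matrix.diagonal_conjTranspose, Matrix.diagonal_mul_diagonal, LDL.diag]
    congr 1
    ext i
    have h1 := Complex.pos_iff.1 (hd i)
    simp only [Pi.star_apply, Complex.star_def, Complex.conj_ofReal]
    rw [← Complex.ofReal_mul, Real.mul_self_sqrt h1.1.le]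
    apply Complex.ext
    · simp
    · simp [← h1.2]
  let T := LDL.lower hS * E
  have hTT : T * Tᴴ = M * Mᴴ := by
    conv_rhs => rw [← LDL.lower_conj_diag hS, ← hE]
    simp only [T, Matrix.conjTranspose_mul, Matrix.mul_assoc]
  have hTdet : IsUnit T.det := by
    rw [isUnit_iff_ne_zero]
    intro h0
    have := congrArg Matrix.det hTT
    rw [Matrix.det_mul T, Matrix.det_mul M, h0, zero_mul, Matrix.det_conjTranspose] at this
    rcases mul_eq_zero.1 this.symm with h | h
    · exact hM h
    · exact hM (star_eq_zero.1 h)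
  have hlow : (LDL.lowerInv hS).BlockTriangular OrderDual.toDual := by
    intro i j hij
    exact LDL.lowerInv_triangular hS (OrderDual.toDual_lt_toDual.1 hij)
  have hlow' : (LDL.lower hS).BlockTriangular OrderDual.toDual :=
    Matrix.blockTriangular_inv_of_blockTriangular hlow
  refine ⟨T, T⁻¹ * M, ?_, ?_, ?_⟩
  · intro a b hab
    have : (LDL.lower hS) a b = 0 := hlow' (OrderDual.toDual_lt_toDual.2 hab)
    simp [T, E, Matrix.mul_diagonal, this]
  · rw [Matrix.mem_unitaryGroup_iff, Matrix.star_eq_conjTranspose, Matrix.conjTranspose_mul,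
      Matrix.mul_assoc, ← Matrix.mul_assoc M, ← hTT, Matrix.mul_assoc T, ← Matrix.mul_assoc,
      Matrix.nonsing_inv_mul _ hTdet, Matrix.one_mul, ← Matrix.conjTranspose_mul,
      Matrix.nonsing_inv_mul _ hTdet, Matrix.conjTranspose_one]
  · rw [← Matrix.mul_assoc, Matrix.mul_nonsing_inv _ hTdet, Matrix.one_mul]

/-! ### Measurability -/

lemma meas_of_entries {α : Type*} [MeasurableSpace α] {n : ℕ}
    {f : α → Matrix (Fin n) (Fin n) ℂ} (h : ∀ i j, Measurable fun a => f a i j) :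
    Measurable f :=
  measurable_pi_lambda (X := fun _ : Fin n => Fin n → ℂ) f
    (fun i => measurable_pi_lambda (X := fun _ : Fin n => ℂ) _ (h i))

lemma meas_entry {n : ℕ} (i j : Fin n) :
    Measurable (fun A : Matrix (Fin n) (Fin n) ℂ => A i j) :=
  (measurable_pi_apply (X := fun _ : Fin n => ℂ) j).comp
    (measurable_pi_apply (X := fun _ : Fin n => Fin n → ℂ) i)

lemma meas_mul {α : Type*} [MeasurableSpace α] {n : ℕ}
    {f g : α → Matrix (Fin n) (Fin n) ℂ} (hf : Measurable f) (hg : Measurable g) :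
    Measurable fun a => f a * g a := by
  apply meas_of_entries
  intro i j
  simp only [Matrix.mul_apply]
  exact Finset.measurable_sum _ fun k _ =>
    ((meas_entry i k).comp hf).mul ((meas_entry k j).comp hg)

lemma meas_conjTranspose {α : Type*} [MeasurableSpace α] {n : ℕ}
    {f : α → Matrix (Fin n) (Fin n) ℂ} (hf : Measurable f) :
    Measurable fun a => (f a)ᴴ := by
  apply meas_of_entries
  intro i j
  simp only [Matrix.conjTranspose_apply]
  exact Complex.continuous_conj.measurable.comp ((meas_entry j i).comp hf)

lemma meas_of {n : ℕ} : Measurable (fun g : Fin n → Fin n → ℂ => Matrix.of g) := measurable_id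

lemma meas_herm {n : ℕ} : Measurable (hermOfCoords (n := n)) := by
  apply meas_of_entries
  intro i j
  simp only [hermOfCoords, Matrix.of_apply]
  split_ifs with h h'
  · exact (measurable_pi_apply _).comp measurable_snd
  · exact Complex.continuous_conj.measurable.comp ((measurable_pi_apply _).comp measurable_snd)
  · exact Complex.measurable_ofReal.comp ((measurable_pi_apply _).comp measurable_fst)

lemma cont_pminor {n : ℕ} (j : ℕ) :
    Continuous (fun y : Matrix (Fin n) (Fin n) ℂ => pminor y j) := by
  unfold pminor
  apply Complex.continuous_re.comp
  apply Continuous.matrix_det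
  refine continuous_matrix fun p q => ?_
  exact continuous_id.matrix_elem _ _

lemma meas_pminor {n : ℕ} (j : ℕ) :
    Measurable (fun y : Matrix (Fin n) (Fin n) ℂ => pminor y j) := by
  have : Continuous (fun y : Fin n → Fin n → ℂ => pminor (Matrix.of y) j) := cont_pminor j
  exact this.measurable

lemma meas_sphProd {n : ℕ} (s : ℕ → ℂ) (L : ℕ → ℤ) :
    Measurable (fun y : Matrix (Fin n) (Fin n) ℂ => sphProd n s L y) := by
  unfold sphProd
  apply Finset.measurable_prod
  intro j _
  have hp := meas_pminor (n := n) (j + 1)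
  have hsign : Measurable Real.sign := by
    unfold Real.sign
    exact Measurable.ite measurableSet_Iio measurable_const
      (Measurable.ite measurableSet_Ioi measurable_const measurable_const)
  refine Measurable.ite (measurableSet_eq_fun hp measurable_const) measurable_const ?_
  refine Measurable.mul ?_ ?_
  · exact (Complex.measurable_ofReal.comp (hsign.comp hp)).pow_const _
  · exact (Complex.measurable_ofReal.comp
      (continuous_abs.measurable.comp hp)).pow_const _

lemma norm_sphProd {n : ℕ} (s : ℕ → ℂ) (L : ℕ → ℤ) (y : Matrix (Fin n) (Fin n) ℂ) :
    ‖sphProd n s L y‖ = absProdR n (fun j => (s j).re) y := by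
  unfold sphProd absProdR
  rw [norm_prod]
  apply Finset.prod_congr rfl
  intro j _
  split_ifs with h h2
  · simp
  · have hs : |Real.sign (pminor y (j+1))| = 1 := by
      rcases lt_or_gt_of_ne h with hb' | hb'
      · rw [Real.sign_of_neg hb']; simp
      · rw [Real.sign_of_pos hb']; simp
    rw [norm_mul, norm_zpow, Complex.norm_real, Real.norm_eq_abs, hs, _root_.one_zpow, one_mul,
      Complex.norm_cpow_eq_rpow_re_of_pos (abs_pos.2 h)]
    simp [sNext, h2]
  · have hs : |Real.sign (pminor y (j+1))| = 1 := by
      rcases lt_or_gt_of_ne h with hb' | hb'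
      · rw [Real.sign_of_neg hb']; simp
      · rw [Real.sign_of_pos hb']; simp
    rw [norm_mul, norm_zpow, Complex.norm_real, Real.norm_eq_abs, hs, _root_.one_zpow, one_mul,
      Complex.norm_cpow_eq_rpow_re_of_pos (abs_pos.2 h)]
    simp [sNext, h2]

lemma norm_Nsph_le {n : ℕ} (μ : Measure (Matrix (Fin n) (Fin n) ℂ)) (s : ℕ → ℂ) (L : ℕ → ℤ)
    (x : Matrix (Fin n) (Fin n) ℂ) :
    ‖Nsph n n μ s L x‖ ≤ NabsR n μ (fun j => (s j).re) x := by
  unfold Nsph NabsR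
  refine (norm_integral_le_integral_norm _).trans_eq ?_
  simp only [norm_sphProd]

lemma meas_Nsph {n : ℕ} (μ : Measure (Matrix (Fin n) (Fin n) ℂ)) [SFinite μ] (s : ℕ → ℂ)
    (L : ℕ → ℤ) : Measurable (fun x => Nsph n n μ s L x) := by
  unfold Nsph
  apply StronglyMeasurable.measurable
  apply StronglyMeasurable.integral_prod_right
  apply Measurable.stronglyMeasurable
  exact (meas_sphProd s L).comp
    (meas_mul (meas_mul measurable_snd measurable_fst) (meas_conjTranspose measurable_snd))

lemma exists_bound {n : ℕ} (s : ℕ → ℂ) (hs : ∀ j < n, 1 ≤ (s j - sNext n s j).re) (L : ℕ → ℤ)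
    (g x : Matrix (Fin n) (Fin n) ℂ) :
    ∃ C : ℝ, ∀ k ∈ Matrix.unitaryGroup (Fin n) ℂ, ∀ k' ∈ Matrix.unitaryGroup (Fin n) ℂ,
      ‖sphProd n s L (k' * (g * (k * x * kᴴ) * gᴴ) * k'ᴴ)‖ ≤ C := by
  let c : Matrix (Fin n) (Fin n) ℂ → ℝ := fun y =>
    ∏ j ∈ Finset.range n, |pminor y (j + 1)| ^ ((s j - sNext n s j - 1).re)
  have hc : Continuous c := by
    apply continuous_finsetProd
    intro j hj
    apply (continuous_abs.comp (cont_pminor (j+1))).rpow_const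
    intro y
    right
    have := hs j (Finset.mem_range.1 hj)
    simp only [Complex.sub_re, Complex.one_re] at this ⊢
    linarith
  have hle : ∀ y, ‖sphProd n s L y‖ ≤ c y := by
    intro y
    rw [norm_sphProd]
    unfold absProdR
    apply Finset.prod_le_prod
    · intro j _
      split_ifs <;> positivity
    · intro j _
      split_ifs with h h2
      · positivity
      · simp [sNext, h2]
      · simp [sNext, h2]
  let K : Set (Matrix (Fin n) (Fin n) ℂ) :=
    Set.pi Set.univ fun _ => Set.pi Set.univ fun _ => Metric.closedBall 0 1
  have hK : IsCompact K :=
    isCompact_univ_pi fun _ => isCompact_univ_pi fun _ => isCompact_closedBall _ _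
  have hUK : ∀ k ∈ Matrix.unitaryGroup (Fin n) ℂ, k ∈ K := by
    intro k hk i _ j _
    simpa using entry_norm_bound_of_unitary hk i j
  have hcont : Continuous (fun p : Matrix (Fin n) (Fin n) ℂ × Matrix (Fin n) (Fin n) ℂ =>
      c (p.2 * (g * (p.1 * x * p.1ᴴ) * gᴴ) * p.2ᴴ)) := by
    apply hc.comp
    fun_prop
  obtain ⟨C, hC⟩ := (hK.prod hK).bddAbove_image hcont.continuousOn
  refine ⟨C, fun k hk k' hk' => (hle _).trans ?_⟩
  exact hC ⟨(k, k'), ⟨hUK k hk, hUK k' hk'⟩, rfl⟩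

/-- The spherical function identity. -/
lemma sph_identity {n : ℕ} (hn : 1 ≤ n) (s : ℕ → ℂ)
    (hs : ∀ j < n, 1 ≤ (s j - sNext n s j).re) (L : ℕ → ℤ)
    (μ : Measure (Matrix (Fin n) (Fin n) ℂ)) (hμ : IsHaarUnitary n μ)
    (g x : Matrix (Fin n) (Fin n) ℂ) :
    ∫ k, Nsph n n μ s L (g * (k * x * kᴴ) * gᴴ) ∂μ =
      Nsph n n μ s (Lstd n) (g * gᴴ) * Nsph n n μ s L x := by
  obtain ⟨hprob, hsupp, hinv⟩ := hμ
  have hae : ∀ᵐ k ∂μ, k ∈ Matrix.unitaryGroup (Fin n) ℂ := hsupp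
  have hmeas : Measurable (fun p : Matrix (Fin n) (Fin n) ℂ × Matrix (Fin n) (Fin n) ℂ =>
      sphProd n s L (p.2 * (g * (p.1 * x * p.1ᴴ) * gᴴ) * p.2ᴴ)) := by
    refine (meas_sphProd s L).comp ?_
    have h1 : Measurable (fun p : Matrix (Fin n) (Fin n) ℂ × Matrix (Fin n) (Fin n) ℂ => p.1) :=
      measurable_fst
    have h2 : Measurable (fun p : Matrix (Fin n) (Fin n) ℂ × Matrix (Fin n) (Fin n) ℂ => p.2) :=
      measurable_snd
    exact meas_mul (meas_mul h2 (meas_mul (meas_mul measurable_const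
      (meas_mul (meas_mul h1 measurable_const) (meas_conjTranspose h1))) measurable_const))
      (meas_conjTranspose h2)
  obtain ⟨C, hC⟩ := exists_bound s hs L g x
  have hint : Integrable (fun p : Matrix (Fin n) (Fin n) ℂ × Matrix (Fin n) (Fin n) ℂ =>
      sphProd n s L (p.2 * (g * (p.1 * x * p.1ᴴ) * gᴴ) * p.2ᴴ)) (μ.prod μ) := by
    refine Integrable.of_bound hmeas.aestronglyMeasurable C ?_
    have ha : ∀ᵐ p ∂(μ.prod μ), p.1 ∈ Matrix.unitaryGroup (Fin n) ℂ :=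
      Measure.quasiMeasurePreserving_fst.ae hae
    have hb : ∀ᵐ p ∂(μ.prod μ), p.2 ∈ Matrix.unitaryGroup (Fin n) ℂ :=
      Measure.quasiMeasurePreserving_snd.ae hae
    filter_upwards [ha, hb] with p h1 h2
    exact hC _ h1 _ h2
  have key : ∀ k' : Matrix (Fin n) (Fin n) ℂ,
      ∫ k, sphProd n s L (k' * (g * (k * x * kᴴ) * gᴴ) * k'ᴴ) ∂μ =
      sphProd n s (Lstd n) (k' * (g * gᴴ) * k'ᴴ) * Nsph n n μ s L x := by
    intro k'
    by_cases hdet : (k' * g).det = 0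
    · rw [Matrix.det_mul] at hdet
      have h1 : sphProd n s (Lstd n) (k' * (g * gᴴ) * k'ᴴ) = 0 := by
        apply sphProd_eq_zero hn
        rw [Matrix.det_mul, Matrix.det_mul, Matrix.det_mul, ← mul_assoc k'.det, hdet]
        simp
      have h2 : ∀ k, sphProd n s L (k' * (g * (k * x * kᴴ) * gᴴ) * k'ᴴ) = 0 := by
        intro k
        apply sphProd_eq_zero hn
        rw [Matrix.det_mul, Matrix.det_mul, Matrix.det_mul, Matrix.det_mul,
          ← mul_assoc k'.det, ← mul_assoc k'.det, hdet]
        simp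
      simp [h1, h2]
    · obtain ⟨T, u, hT, hu, hTu⟩ := exists_tri (k' * g) hdet
      have hu' : u * uᴴ = 1 := by
        rw [← Matrix.star_eq_conjTranspose]
        exact Matrix.mem_unitaryGroup_iff.1 hu
      have e1 : ∀ z, k' * (g * z * gᴴ) * k'ᴴ = T * (u * z * uᴴ) * Tᴴ := by
        intro z
        calc k' * (g * z * gᴴ) * k'ᴴ = (k' * g) * z * (k' * g)ᴴ := by
              simp only [Matrix.conjTranspose_mul, Matrix.mul_assoc]
          _ = _ := by
              rw [hTu]
              simp only [Matrix.conjTranspose_mul, Matrix.mul_assoc]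
      have e2 : k' * (g * gᴴ) * k'ᴴ = T * Tᴴ := by
        have := e1 1
        rwa [Matrix.mul_one, Matrix.mul_one, hu', Matrix.mul_one] at this
      rw [e2]
      simp only [e1, sphProd_conj s L (Lstd n) T _ hT]
      rw [integral_const_mul]
      congr 1
      have hmU : Measurable (fun A : Matrix (Fin n) (Fin n) ℂ => u * A) :=
        meas_mul measurable_const measurable_id
      unfold Nsph
      conv_rhs => rw [← hinv u hu]
      rw [integral_map hmU.aemeasurable]
      · simp only [Matrix.conjTranspose_mul, Matrix.mul_assoc]
      · refine Measurable.aestronglyMeasurable ?_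
        exact (meas_sphProd s L).comp (meas_mul (meas_mul measurable_id measurable_const)
          (meas_conjTranspose measurable_id))
  calc ∫ k, Nsph n n μ s L (g * (k * x * kᴴ) * gᴴ) ∂μ
      = ∫ k, ∫ k', sphProd n s L (k' * (g * (k * x * kᴴ) * gᴴ) * k'ᴴ) ∂μ ∂μ := rfl
    _ = ∫ k', ∫ k, sphProd n s L (k' * (g * (k * x * kᴴ) * gᴴ) * k'ᴴ) ∂μ ∂μ :=
        integral_integral_swap hint
    _ = _ := by
        simp only [key]
        rw [integral_mul_const]
        rfl

/-! ### Invariance of Lebesgue measure -/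

lemma mp_row {n : ℕ} (k : Matrix (Fin n) (Fin n) ℂ) (hk : k ∈ Matrix.unitaryGroup (Fin n) ℂ) :
    MeasurePreserving (fun v : Fin n → ℂ => v ᵥ* k) volume volume := by
  have hdet : LinearMap.det ((Matrix.toLin' kᵀ).restrictScalars ℝ) = 1 := by
    rw [LinearMap.det_restrictScalars, LinearMap.det_toLin', Matrix.det_transpose,
      Algebra.norm_complex_apply]
    have h := congrArg Matrix.det (Matrix.mem_unitaryGroup_iff.1 hk)
    rw [Matrix.det_mul, Matrix.star_eq_conjTranspose, Matrix.det_conjTranspose,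
      Matrix.det_one, Complex.star_def, Complex.mul_conj] at h
    exact_mod_cast h
  have hf : (fun v : Fin n → ℂ => v ᵥ* k) = ((Matrix.toLin' kᵀ).restrictScalars ℝ) := by
    ext v i
    simp [Matrix.mulVec_transpose]
  rw [hf]
  refine ⟨(LinearMap.continuous_of_finiteDimensional _).measurable, ?_⟩
  rw [Measure.map_linearMap_addHaar_eq_smul_addHaar _ (by rw [hdet]; exact one_ne_zero), hdet]
  simp

lemma mp_mul {n : ℕ} (k : Matrix (Fin n) (Fin n) ℂ) (hk : k ∈ Matrix.unitaryGroup (Fin n) ℂ) :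
    MeasurePreserving (fun g : Fin n → Fin n → ℂ => fun i => g i ᵥ* k) volume volume :=
  volume_preserving_pi (fun _ => mp_row k hk)

lemma of_mul {n : ℕ} (k : Matrix (Fin n) (Fin n) ℂ) (g : Fin n → Fin n → ℂ) :
    Matrix.of (fun i => g i ᵥ* k) = Matrix.of g * k := by
  ext i j
  simp [Matrix.mul_apply, Matrix.vecMul, dotProduct]

end aux

/-- The spherical transform factorizes the multiplicative convolution of a
bi-unitarily invariant density on `ℂ^{n×n}` with a unitarily invariant density on `Herm_n`. -/
theorem statement6 (n : ℕ) (hn : 1 ≤ n)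
    (P : Matrix (Fin n) (Fin n) ℂ → ℝ)
    (hPint : Integrable (fun g : Fin n → Fin n → ℂ => P (Matrix.of g)))
    (hPinv : ∀ u v : Matrix (Fin n) (Fin n) ℂ, u ∈ Matrix.unitaryGroup (Fin n) ℂ →
      v ∈ Matrix.unitaryGroup (Fin n) ℂ → ∀ g : Matrix (Fin n) (Fin n) ℂ, P (u * g * v) = P g)
    (Q : Matrix (Fin n) (Fin n) ℂ → ℝ)
    (hQint : Integrable (fun x : HermCoords n => Q (hermOfCoords x)))
    (hQinv : ∀ u : Matrix (Fin n) (Fin n) ℂ, u ∈ Matrix.unitaryGroup (Fin n) ℂ →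
      ∀ x : Matrix (Fin n) (Fin n) ℂ, x.IsHermitian → Q (u * x * uᴴ) = Q x)
    (s : ℕ → ℂ) (hs : ∀ j < n, 1 ≤ (s j - sNext n s j).re)
    (L : ℕ → ℤ) (hL : ∀ j < n, L j = 0 ∨ L j = 1)
    (μ : Measure (Matrix (Fin n) (Fin n) ℂ)) (hμ : IsHaarUnitary n μ)
    (habs : Integrable (fun p : HermCoords n × (Fin n → Fin n → ℂ) =>
      NabsR n μ (fun j => (s j).re)
          (Matrix.of p.2 * hermOfCoords p.1 * (Matrix.of p.2)ᴴ) *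
        |P (Matrix.of p.2)| * |Q (hermOfCoords p.1)|))
    (habsP : Integrable (fun g : Fin n → Fin n → ℂ =>
      NabsR n μ (fun j => (s j).re) (Matrix.of g * (Matrix.of g)ᴴ) * |P (Matrix.of g)|))
    (habsQ : Integrable (fun x : HermCoords n =>
      NabsR n μ (fun j => (s j).re) (hermOfCoords x) * |Q (hermOfCoords x)|)) :
    (∫ x : HermCoords n, ∫ g : Fin n → Fin n → ℂ,
        Nsph n n μ s L (Matrix.of g * hermOfCoords x * (Matrix.of g)ᴴ) *
          (P (Matrix.of g) : ℂ) * (Q (hermOfCoords x) : ℂ)) =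
      (∫ g : Fin n → Fin n → ℂ,
        Nsph n n μ s (Lstd n) (Matrix.of g * (Matrix.of g)ᴴ) * (P (Matrix.of g) : ℂ)) *
      (∫ x : HermCoords n, Nsph n n μ s L (hermOfCoords x) * (Q (hermOfCoords x) : ℂ)) := by
  have hprob : IsProbabilityMeasure μ := hμ.1
  have hae : ∀ᵐ k ∂μ, k ∈ Matrix.unitaryGroup (Fin n) ℂ := hμ.2.1
  let Φ : HermCoords n × (Fin n → Fin n → ℂ) → ℂ := fun p =>
    Nsph n n μ s L (Matrix.of p.2 * hermOfCoords p.1 * (Matrix.of p.2)ᴴ) *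
          (P (Matrix.of p.2) : ℂ) * (Q (hermOfCoords p.1) : ℂ)
  let H : Matrix (Fin n) (Fin n) ℂ → HermCoords n × (Fin n → Fin n → ℂ) → ℂ := fun k p =>
    Nsph n n μ s L (Matrix.of p.2 * (k * hermOfCoords p.1 * kᴴ) * (Matrix.of p.2)ᴴ) *
          (P (Matrix.of p.2) : ℂ) * (Q (hermOfCoords p.1) : ℂ)
  have hPm : AEStronglyMeasurable
      (fun p : HermCoords n × (Fin n → Fin n → ℂ) => (P (Matrix.of p.2) : ℂ)) volume :=
    (Complex.continuous_ofReal.comp_aestronglyMeasurable hPint.1).comp_quasiMeasurePreserving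
      Measure.quasiMeasurePreserving_snd
  have hQm : AEStronglyMeasurable
      (fun p : HermCoords n × (Fin n → Fin n → ℂ) => (Q (hermOfCoords p.1) : ℂ)) volume :=
    (Complex.continuous_ofReal.comp_aestronglyMeasurable hQint.1).comp_quasiMeasurePreserving
      Measure.quasiMeasurePreserving_fst
  have hN := meas_Nsph μ s L
  have hΦm : AEStronglyMeasurable Φ volume := by
    refine AEStronglyMeasurable.mul (AEStronglyMeasurable.mul ?_ hPm) hQm
    refine (hN.comp ?_).aestronglyMeasurable
    have h2 : Measurable (fun p : HermCoords n × (Fin n → Fin n → ℂ) => Matrix.of p.2) :=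
      meas_of.comp measurable_snd
    exact meas_mul (meas_mul h2 (meas_herm.comp measurable_fst)) (meas_conjTranspose h2)
  have hΦ : Integrable Φ volume := by
    refine habs.mono' hΦm (Eventually.of_forall fun p => ?_)
    simp only [Φ, norm_mul, Complex.norm_real, Real.norm_eq_abs]
    gcongr
    exact norm_Nsph_le _ _ _ _
  have hmp : ∀ k ∈ Matrix.unitaryGroup (Fin n) ℂ, MeasurePreserving
      (fun p : HermCoords n × (Fin n → Fin n → ℂ) => (p.1, fun i => p.2 i ᵥ* k))
      volume volume := fun k hk =>
    (MeasurePreserving.id volume).prod (mp_mul k hk)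
  have hHΦ : ∀ k ∈ Matrix.unitaryGroup (Fin n) ℂ, ∀ p,
      H k p = Φ (p.1, fun i => p.2 i ᵥ* k) := by
    intro k hk p
    have hPk : P (Matrix.of p.2 * k) = P (Matrix.of p.2) := by
      have := hPinv 1 k (one_mem _) hk (Matrix.of p.2)
      rwa [Matrix.one_mul] at this
    simp only [H, Φ, of_mul, hPk, Matrix.conjTranspose_mul, Matrix.mul_assoc]
  have hHint1 : ∀ k ∈ Matrix.unitaryGroup (Fin n) ℂ, Integrable (H k) volume := by
    intro k hk
    have := (hmp k hk).integrable_comp_of_integrable hΦ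
    refine this.congr (Eventually.of_forall fun p => ?_)
    exact (hHΦ k hk p).symm
  have hcomp : ∀ k ∈ Matrix.unitaryGroup (Fin n) ℂ,
      ∀ {F : Type} [NormedAddCommGroup F] [NormedSpace ℝ F]
      (f : HermCoords n × (Fin n → Fin n → ℂ) → F), AEStronglyMeasurable f volume →
      ∫ p : HermCoords n × (Fin n → Fin n → ℂ), f (p.1, fun i => p.2 i ᵥ* k) = ∫ p, f p := by
    intro k hk F _ _ f hf
    have h := hmp k hk
    conv_rhs => rw [← h.map_eq]
    rw [integral_map h.measurable.aemeasurable (by rwa [h.map_eq])]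
  have hHm : AEStronglyMeasurable (Function.uncurry H) (μ.prod volume) := by
    refine AEStronglyMeasurable.mul (AEStronglyMeasurable.mul ?_ ?_) ?_
    · refine (hN.comp ?_).aestronglyMeasurable
      have h2 : Measurable (fun q : Matrix (Fin n) (Fin n) ℂ ×
          (HermCoords n × (Fin n → Fin n → ℂ)) => Matrix.of q.2.2) :=
        meas_of.comp (measurable_snd.comp measurable_snd)
      have h1 : Measurable (fun q : Matrix (Fin n) (Fin n) ℂ ×
          (HermCoords n × (Fin n → Fin n → ℂ)) => q.1) := measurable_fst
      exact meas_mul (meas_mul h2 (meas_mul (meas_mul h1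
        (meas_herm.comp (measurable_fst.comp measurable_snd))) (meas_conjTranspose h1)))
        (meas_conjTranspose h2)
    · exact hPm.comp_quasiMeasurePreserving Measure.quasiMeasurePreserving_snd
    · exact hQm.comp_quasiMeasurePreserving Measure.quasiMeasurePreserving_snd
  have hHint : Integrable (Function.uncurry H) (μ.prod volume) := by
    rw [integrable_prod_iff hHm]
    refine ⟨hae.mono fun k hk => hHint1 k hk, ?_⟩
    refine (integrable_const (∫ p, ‖Φ p‖)).congr (hae.mono fun k hk => ?_)
    simp only [Function.uncurry_apply_pair, hHΦ k hk]
    exact (hcomp k hk (fun p => ‖Φ p‖) hΦm.norm).symm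
  have hH1 : ∫ k, (∫ p, H k p) ∂μ = ∫ p, Φ p := by
    have : (fun k => ∫ p, H k p) =ᵐ[μ] fun _ => ∫ p, Φ p := by
      refine hae.mono fun k hk => ?_
      simp only [hHΦ k hk]
      exact hcomp k hk Φ hΦm
    rw [integral_congr_ae this]
    simp
  have hH2 : ∀ p : HermCoords n × (Fin n → Fin n → ℂ), ∫ k, H k p ∂μ =
      (Nsph n n μ s L (hermOfCoords p.1) * (Q (hermOfCoords p.1) : ℂ)) *
      (Nsph n n μ s (Lstd n) (Matrix.of p.2 * (Matrix.of p.2)ᴴ) * (P (Matrix.of p.2) : ℂ)) := by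
    intro p
    simp only [H]
    rw [integral_mul_const, integral_mul_const, sph_identity hn s hs L μ hμ]
    ring
  calc _ = ∫ p, Φ p := (integral_prod Φ hΦ).symm
    _ = ∫ k, (∫ p, H k p) ∂μ := hH1.symm
    _ = ∫ p, ∫ k, H k p ∂μ := integral_integral_swap hHint
    _ = _ := by
      simp only [hH2]
      rw [Measure.volume_eq_prod, integral_prod_mul
        (fun x : HermCoords n => Nsph n n μ s L (hermOfCoords x) * (Q (hermOfCoords x) : ℂ))
        (fun g : Fin n → Fin n → ℂ => Nsph n n μ s (Lstd n) (Matrix.of g * (Matrix.of g)ᴴ) *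
          (P (Matrix.of g) : ℂ)), mul_comm]


end RMT
end
end
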